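/- Let n ≥ 3 be an integer, n − 1 < β < α ≤ ⌈α⌉ = n, a > 0, and let f : ℝ → ℝ, q : [0,∞) → ℝ, g : [0,∞) → ℝ be continuous satisfying (G1) x·f(x) > 0 for all x ≠ 0, (H) there exist T_1 > 0 and c_3 > 0 with q(t) ≥ c_3 for all t ≥ T_1, and (K) there exist σ ∈ (n−β,1), c_4 > 0 and T_2 > 0 with g(t) ≥ c_4 t^{n−β−σ} for all t ≥ T_2. Let x be a solution on [0,∞) of (^C D^α_{0^+} x)(t) + a·(^C D^β_{0^+} x)(t) + q(t)·f(x(t)) + sgn(x(t))·g(t) = 0, t > 0, with x(0) = x_0, x^{(i)}(0) = x_i for i = 1,…,n−1, and let y_1, y_2 be the associated functions. If x is eventually positive and y_1 is eventually negative, then lim_{t→∞} y_1(t) = 0 and y_2 is eventually positive. -/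

import Mathlib

open MeasureTheory Filter Set

noncomputable def fracInt (γ : ℝ) (f : ℝ → ℝ) (t : ℝ) : ℝ :=
  (1 / Real.Gamma γ) * ∫ s in (0:ℝ)..t, (t - s) ^ (γ - 1) * f s

noncomputable def taylorPolyAt0 (n : ℕ) (f : ℝ → ℝ) (t : ℝ) : ℝ :=
  ∑ k ∈ Finset.range n, iteratedDeriv k f 0 / (Nat.factorial k : ℝ) * t ^ k

noncomputable def caputoD (γ : ℝ) (f : ℝ → ℝ) : ℝ → ℝ :=
  iteratedDeriv ⌈γ⌉₊
    (fun t => fracInt ((⌈γ⌉₊ : ℝ) - γ) (fun s => f s - taylorPolyAt0 ⌈γ⌉₊ f s) t)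

def ContCaputoDiffOnIci (γ : ℝ) (f : ℝ → ℝ) : Prop :=
  ContDiffOn ℝ (⌈γ⌉₊ - 1 : ℕ) f (Set.Ici 0) ∧ ContinuousOn (caputoD γ f) (Set.Ici 0)

def Oscillatory (x : ℝ → ℝ) : Prop :=
  ∃ u : ℕ → ℝ, (∀ n, 0 ≤ u n) ∧ Filter.Tendsto u Filter.atTop Filter.atTop ∧ ∀ n, x (u n) = 0

noncomputable def assocY (n : ℕ) (α β a : ℝ) (ξ : ℕ → ℝ) (x : ℝ → ℝ) : ℕ → ℝ → ℝ
  | 1 => fun t => fracInt ((n : ℝ) - α) x t + a * fracInt ((n : ℝ) - β) x t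
  | 2 => fun t => caputoD (α - n + 1) x t + a * caputoD (β - n + 1) x t
      + ξ 0 * t ^ ((n : ℝ) - α - 1) / Real.Gamma ((n : ℝ) - α)
      + a * ξ 0 * t ^ ((n : ℝ) - β - 1) / Real.Gamma ((n : ℝ) - β)
  | i => fun t => caputoD (α - n - 1 + i) x t + a * caputoD (β - n - 1 + i) x t
      + (∑ k ∈ Finset.range (i - 1), ξ k *
          (∏ j ∈ Finset.range (i - 1 - k), ((n : ℝ) - α - i + 2 + k + j)) *
          t ^ ((n : ℝ) - α - i + 1 + k) / Real.Gamma ((n : ℝ) - α + 1))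
      + (∑ k ∈ Finset.range (i - 1), a * ξ k *
          (∏ j ∈ Finset.range (i - 1 - k), ((n : ℝ) - β - i + 2 + k + j)) *
          t ^ ((n : ℝ) - β - i + 1 + k) / Real.Gamma ((n : ℝ) - β + 1))

def AbsContOnInterval (f : ℝ → ℝ) (A B : ℝ) : Prop :=
  ∀ ε > (0:ℝ), ∃ δ > (0:ℝ), ∀ m : ℕ, ∀ s t : ℕ → ℝ,
    (∀ i < m, A ≤ s i ∧ s i ≤ t i ∧ t i ≤ B) →
    (∀ i < m, ∀ j < m, i ≠ j → Disjoint (Set.Ioo (s i) (t i)) (Set.Ioo (s j) (t j))) →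
    (∑ i ∈ Finset.range m, (t i - s i)) < δ →
    (∑ i ∈ Finset.range m, |f (t i) - f (s i)|) < ε

theorem integral_beta_kernel {p q t : ℝ} (hp : 0 < p) (hq : 0 < q) (ht : 0 < t) :
    ∫ s in (0:ℝ)..t, (t - s) ^ (p - 1) * s ^ (q - 1) =
      Real.Gamma p * Real.Gamma q / Real.Gamma (p + q) * t ^ (p + q - 1) := by
  have h := Complex.betaIntegral_scaled (q : ℂ) (p : ℂ) ht
  rw [Complex.betaIntegral_eq_Gamma_mul_div _ _ (by simpa) (by simpa)] at h
  have h2 : ∫ x in (0:ℝ)..t, (x : ℂ) ^ ((q : ℂ) - 1) * ((t : ℂ) - x) ^ ((p : ℂ) - 1) =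
      ((∫ s in (0:ℝ)..t, (t - s) ^ (p - 1) * s ^ (q - 1) : ℝ) : ℂ) := by
    rw [← intervalIntegral.integral_ofReal]
    refine intervalIntegral.integral_congr fun s hs => ?_
    rw [uIcc_of_le ht.le] at hs
    rw [Complex.ofReal_mul, Complex.ofReal_cpow (by linarith [hs.2]), Complex.ofReal_cpow hs.1]
    push_cast
    ring
  rw [h2] at h
  have h3 : ((∫ s in (0:ℝ)..t, (t - s) ^ (p - 1) * s ^ (q - 1) : ℝ) : ℂ) =
      ((Real.Gamma p * Real.Gamma q / Real.Gamma (p + q) * t ^ (p + q - 1) : ℝ) : ℂ) := by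
    rw [h]
    push_cast
    rw [Complex.ofReal_cpow ht.le, ← Complex.ofReal_add, Complex.Gamma_ofReal, Complex.Gamma_ofReal,
      Complex.Gamma_ofReal]
    push_cast
    rw [add_comm (q : ℂ) p, add_comm q p]
    ring
  exact_mod_cast h3

theorem fracInt_rpow {p q t : ℝ} (hp : 0 < p) (hq : 0 < q) (ht : 0 < t) :
    fracInt p (fun s => s ^ (q - 1)) t =
      Real.Gamma q / Real.Gamma (p + q) * t ^ (p + q - 1) := by
  have := (Real.Gamma_pos_of_pos hp).ne'
  have := (Real.Gamma_pos_of_pos (add_pos hp hq)).ne'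
  rw [fracInt, integral_beta_kernel hp hq ht]
  field_simp

theorem fracInt_const {p t : ℝ} (c : ℝ) (hp : 0 < p) (ht : 0 < t) :
    fracInt p (fun _ => c) t = c / Real.Gamma (p + 1) * t ^ p := by
  have h := fracInt_rpow hp one_pos ht
  simp only [sub_self, Real.rpow_zero, Real.Gamma_one, add_sub_cancel_right] at h
  simp only [fracInt, mul_one, intervalIntegral.integral_mul_const] at h ⊢
  linear_combination c * h

theorem fracInt_zero_order (f : ℝ → ℝ) (t : ℝ) : fracInt 0 f t = 0 := by
  simp [fracInt]

theorem fracInt_one_order (f : ℝ → ℝ) (t : ℝ) : fracInt 1 f t = ∫ s in (0:ℝ)..t, f s := by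
  simp [fracInt]

theorem intervalIntegrable_sub_rpow {γ : ℝ} (hγ : 0 < γ) (t a b : ℝ) :
    IntervalIntegrable (fun s => (t - s) ^ (γ - 1)) volume a b := by
  have h := (intervalIntegral.intervalIntegrable_rpow' (a := t - a) (b := t - b)
    (r := γ - 1) (by linarith)).comp_sub_left t
  simpa using h

theorem intervalIntegrable_kernel_mul {γ : ℝ} (hγ : 0 < γ) (t : ℝ) {a b : ℝ} {f : ℝ → ℝ}
    (hf : ContinuousOn f (uIcc a b)) :
    IntervalIntegrable (fun s => (t - s) ^ (γ - 1) * f s) volume a b :=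
  (intervalIntegrable_sub_rpow hγ t a b).mul_continuousOn hf

theorem fracInt_congr {γ t : ℝ} {f g : ℝ → ℝ} (ht : 0 ≤ t) (h : ∀ s ∈ Icc 0 t, f s = g s) :
    fracInt γ f t = fracInt γ g t := by
  unfold fracInt
  congr 1
  refine intervalIntegral.integral_congr fun s hs => ?_
  rw [uIcc_of_le ht] at hs
  simp only [h s hs]

theorem fracInt_add {γ t : ℝ} {f g : ℝ → ℝ}
    (hf : IntervalIntegrable (fun s => (t - s) ^ (γ - 1) * f s) volume 0 t)
    (hg : IntervalIntegrable (fun s => (t - s) ^ (γ - 1) * g s) volume 0 t) :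
    fracInt γ (fun s => f s + g s) t = fracInt γ f t + fracInt γ g t := by
  unfold fracInt
  rw [← mul_add, ← intervalIntegral.integral_add hf hg]
  simp only [mul_add]

theorem fracInt_sub {γ t : ℝ} {f g : ℝ → ℝ}
    (hf : IntervalIntegrable (fun s => (t - s) ^ (γ - 1) * f s) volume 0 t)
    (hg : IntervalIntegrable (fun s => (t - s) ^ (γ - 1) * g s) volume 0 t) :
    fracInt γ (fun s => f s - g s) t = fracInt γ f t - fracInt γ g t := by
  unfold fracInt
  rw [← mul_sub, ← intervalIntegral.integral_sub hf hg]
  simp only [mul_sub]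

theorem fracInt_const_mul (γ c : ℝ) (f : ℝ → ℝ) (t : ℝ) :
    fracInt γ (fun s => c * f s) t = c * fracInt γ f t := by
  unfold fracInt
  rw [mul_left_comm, ← intervalIntegral.integral_const_mul c]
  simp only [mul_left_comm]

/-- Rescaling to the unit interval turns the fractional integral into a parametric integral with a
fixed integrable kernel. -/
theorem fracInt_eq_unit {γ t : ℝ} (hγ : 0 < γ) (f : ℝ → ℝ) (ht : 0 ≤ t) :
    fracInt γ f t =
      (1 / Real.Gamma γ) * (t ^ γ * ∫ u in (0:ℝ)..1, (1 - u) ^ (γ - 1) * f (t * u)) := by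
  rcases ht.eq_or_lt with rfl | ht
  · simp [fracInt, Real.zero_rpow hγ.ne']
  have h := intervalIntegral.smul_integral_comp_mul_left (a := (0:ℝ)) (b := 1)
    (fun s : ℝ => (t - s) ^ (γ - 1) * f s) t
  simp only [mul_zero, mul_one, smul_eq_mul] at h
  rw [fracInt, ← h]
  congr 1
  have h2 : t ^ γ = t * t ^ (γ - 1) := by
    rw [← Real.rpow_one_add' ht.le (by linarith)]
    congr 1
    ring
  rw [h2, mul_assoc, ← intervalIntegral.integral_const_mul (t ^ (γ - 1))]
  congr 1
  refine intervalIntegral.integral_congr fun u hu => ?_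
  rw [uIcc_of_le zero_le_one] at hu
  rw [show t - t * u = t * (1 - u) by ring, Real.mul_rpow ht.le (by linarith [hu.2])]
  ring

theorem continuousOn_fracInt {γ : ℝ} (hγ : 0 < γ) {f : ℝ → ℝ} (hf : Continuous f) :
    ContinuousOn (fracInt γ f) (Ici 0) := by
  have hpar : ContinuousOn (fun t => ∫ u in (0:ℝ)..1, (1 - u) ^ (γ - 1) * f (t * u)) univ := by
    intro t₀ _
    obtain ⟨M, hM⟩ := (isCompact_Icc (a := -(|t₀| + 1)) (b := |t₀| + 1)).exists_bound_of_continuousOn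
      hf.continuousOn
    refine ContinuousAt.continuousWithinAt ?_
    refine intervalIntegral.continuousAt_of_dominated_interval
      (bound := fun u => ‖(1 - u) ^ (γ - 1)‖ * M) ?_ ?_ ?_ ?_
    · refine Eventually.of_forall fun t => ?_
      exact ((intervalIntegrable_kernel_mul hγ 1 (f := fun u => f (t * u))
        (by fun_prop)).def').aestronglyMeasurable
    · filter_upwards [Metric.ball_mem_nhds t₀ one_pos] with t ht
      refine Eventually.of_forall fun u hu => ?_
      rw [uIoc_of_le zero_le_one] at hu
      rw [norm_mul]
      refine mul_le_mul_of_nonneg_left (hM _ ?_) (norm_nonneg _)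
      have h1 : |t| ≤ |t₀| + 1 := by
        have := abs_sub_abs_le_abs_sub t t₀
        rw [Metric.mem_ball, Real.dist_eq] at ht
        linarith
      have h2 : |t * u| ≤ |t₀| + 1 := by
        rw [abs_mul, abs_of_pos hu.1]
        nlinarith [abs_nonneg t, hu.1, hu.2]
      exact abs_le.mp h2
    · exact (intervalIntegrable_sub_rpow hγ 1 0 1).norm.mul_const M
    · refine Eventually.of_forall fun u _ => ?_
      fun_prop
  have : ContinuousOn (fun t : ℝ => (1 / Real.Gamma γ) *
      (t ^ γ * ∫ u in (0:ℝ)..1, (1 - u) ^ (γ - 1) * f (t * u))) (Ici 0) :=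
    continuousOn_const.mul (((Real.continuous_rpow_const hγ.le).continuousOn).mul
      (hpar.mono (subset_univ _)))
  exact this.congr fun t ht => fracInt_eq_unit hγ f ht

theorem integral_shifted_beta_kernel {p q r t : ℝ} (hp : 0 < p) (hq : 0 < q) (hrt : r < t) :
    ∫ s in r..t, (t - s) ^ (p - 1) * (s - r) ^ (q - 1) =
      Real.Gamma p * Real.Gamma q / Real.Gamma (p + q) * (t - r) ^ (p + q - 1) := by
  rw [← integral_beta_kernel hp hq (sub_pos.mpr hrt)]
  have h := intervalIntegral.integral_comp_add_right (a := 0) (b := t - r)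
    (fun s : ℝ => (t - s) ^ (p - 1) * (s - r) ^ (q - 1)) r
  simp only [zero_add, sub_add_cancel, add_sub_cancel_right] at h
  rw [← h]
  refine intervalIntegral.integral_congr fun s _ => ?_
  rw [show t - (s + r) = t - r - s by ring]

/-- Fubini on the triangle `0 < r < s ≤ t` for the product of two Riemann–Liouville kernels. -/
theorem integral_kernel_swap {p q t : ℝ} (hp : 0 < p) (hq : 0 < q) (ht : 0 < t) {f : ℝ → ℝ}
    (hf : Continuous f) :
    ∫ s in (0:ℝ)..t, (t - s) ^ (p - 1) * ∫ r in (0:ℝ)..s, (s - r) ^ (q - 1) * f r =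
      ∫ r in (0:ℝ)..t, (∫ s in r..t, (t - s) ^ (p - 1) * (s - r) ^ (q - 1)) * f r := by
  set H : ℝ → ℝ → ℝ := fun s r =>
    (t - s) ^ (p - 1) * (Iio s).indicator (fun r => (s - r) ^ (q - 1) * f r) r with hH
  have hset : MeasurableSet {z : ℝ × ℝ | z.2 < z.1} := measurableSet_lt measurable_snd measurable_fst
  have hmeas : Measurable (Function.uncurry H) := by
    have h1 : Function.uncurry H = fun z : ℝ × ℝ => (t - z.1) ^ (p - 1) *
        {z : ℝ × ℝ | z.2 < z.1}.indicator (fun z => (z.1 - z.2) ^ (q - 1) * f z.2) z := by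
      ext z
      simp [hH, Function.uncurry, indicator]
    rw [h1]
    have hf' := hf.measurable
    refine Measurable.mul (by fun_prop) (Measurable.indicator (by fun_prop) hset)
  have hslice : ∀ s ∈ Ioc 0 t, ∀ g : ℝ → ℝ,
      ∫ r in Ioc 0 t, (Iio s).indicator g r = ∫ r in (0:ℝ)..s, g r := by
    intro s hs g
    rw [setIntegral_indicator measurableSet_Iio, intervalIntegral.integral_of_le hs.1.le,
      integral_Ioc_eq_integral_Ioo]
    congr 2
    ext r
    simp only [mem_inter_iff, mem_Ioc, mem_Iio, mem_Ioo]
    exact ⟨fun h => ⟨h.1.1, h.2⟩, fun h => ⟨⟨h.1, by linarith [hs.2]⟩, h.2⟩⟩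
  have hkI : Integrable (Function.uncurry H)
      ((volume.restrict (Ioc 0 t)).prod (volume.restrict (Ioc 0 t))) := by
    rw [integrable_prod_iff hmeas.aestronglyMeasurable]
    constructor
    · refine (ae_restrict_iff' measurableSet_Ioc).mpr (Eventually.of_forall fun s hs => ?_)
      simp only [Function.uncurry, hH]
      refine Integrable.const_mul ?_ _
      rw [integrable_indicator_iff measurableSet_Iio, IntegrableOn,
        Measure.restrict_restrict measurableSet_Iio]
      have := (intervalIntegrable_kernel_mul hq s (a := 0) (b := s) hf.continuousOn)
      rw [intervalIntegrable_iff_integrableOn_Ioc_of_le hs.1.le] at this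
      exact this.mono_set fun r hr => ⟨hr.2.1, (mem_Iio.mp hr.1).le⟩
    · have hG := continuousOn_fracInt hq hf.abs
      have h2 : IntegrableOn (fun s => (t - s) ^ (p - 1) *
          (Real.Gamma q * fracInt q (fun r => |f r|) s)) (Ioc 0 t) := by
        rw [← intervalIntegrable_iff_integrableOn_Ioc_of_le ht.le]
        refine intervalIntegrable_kernel_mul hp t (continuousOn_const.mul (hG.mono ?_))
        rw [uIcc_of_le ht.le]
        exact fun s hs => hs.1
      refine h2.congr ((ae_restrict_iff' measurableSet_Ioc).mpr
        (Eventually.of_forall fun s hs => ?_))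
      have hΓ := (Real.Gamma_pos_of_pos hq).ne'
      simp only [Function.uncurry, hH, norm_mul, Real.norm_eq_abs]
      rw [integral_const_mul, abs_of_nonneg (Real.rpow_nonneg (by linarith [hs.2]) _)]
      congr 1
      rw [fracInt, ← mul_assoc, mul_one_div_cancel hΓ, one_mul, ← hslice s hs]
      refine integral_congr_ae (Eventually.of_forall fun r => ?_)
      by_cases hr : r < s
      · simp only [indicator, mem_Iio, hr, if_true]
        rw [abs_mul, abs_of_nonneg (Real.rpow_nonneg (sub_pos.mpr hr).le _)]
      · simp [indicator, hr]
  have hswap := integral_integral_swap hkI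
  rw [intervalIntegral.integral_of_le ht.le, intervalIntegral.integral_of_le ht.le]
  have hL : ∀ s ∈ Ioc 0 t, ∫ r in Ioc 0 t, H s r =
      (t - s) ^ (p - 1) * ∫ r in (0:ℝ)..s, (s - r) ^ (q - 1) * f r := by
    intro s hs
    simp only [hH]
    rw [integral_const_mul, hslice s hs]
  have hR : ∀ r ∈ Ioc 0 t, ∫ s in Ioc 0 t, H s r =
      (∫ s in r..t, (t - s) ^ (p - 1) * (s - r) ^ (q - 1)) * f r := by
    intro r hr
    rw [intervalIntegral.integral_of_le hr.2, ← integral_mul_const]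
    have : ∀ s, H s r = (Ioi r).indicator
        (fun s => (t - s) ^ (p - 1) * (s - r) ^ (q - 1) * f r) s := by
      intro s
      by_cases hs : r < s
      · simp [hH, indicator, hs, mul_assoc]
      · simp [hH, indicator, hs]
    simp only [this]
    rw [setIntegral_indicator measurableSet_Ioi]
    congr 2
    ext s
    simp only [mem_inter_iff, mem_Ioc, mem_Ioi]
    exact ⟨fun h => ⟨h.2, h.1.2⟩, fun h => ⟨⟨by linarith [hr.1, h.1], h.2⟩, h.1⟩⟩
  rw [← setIntegral_congr_fun measurableSet_Ioc hL, ← setIntegral_congr_fun measurableSet_Ioc hR]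
  exact hswap

theorem fracInt_fracInt {p q t : ℝ} (hp : 0 < p) (hq : 0 < q) (ht : 0 ≤ t) {f : ℝ → ℝ}
    (hf : Continuous f) : fracInt p (fracInt q f) t = fracInt (p + q) f t := by
  rcases ht.eq_or_lt with rfl | ht
  · simp [fracInt]
  have hΓp := (Real.Gamma_pos_of_pos hp).ne'
  have hΓq := (Real.Gamma_pos_of_pos hq).ne'
  have hΓ := (Real.Gamma_pos_of_pos (add_pos hp hq)).ne'
  have h := integral_kernel_swap hp hq ht hf
  have h2 : ∫ r in (0:ℝ)..t, (∫ s in r..t, (t - s) ^ (p - 1) * (s - r) ^ (q - 1)) * f r =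
      Real.Gamma p * Real.Gamma q / Real.Gamma (p + q) *
        ∫ r in (0:ℝ)..t, (t - r) ^ (p + q - 1) * f r := by
    rw [← intervalIntegral.integral_const_mul, intervalIntegral.integral_of_le ht.le,
      intervalIntegral.integral_of_le ht.le, integral_Ioc_eq_integral_Ioo,
      integral_Ioc_eq_integral_Ioo]
    refine setIntegral_congr_fun measurableSet_Ioo fun r hr => ?_
    rw [integral_shifted_beta_kernel hp hq hr.2]
    ring
  rw [h2] at h
  simp only [fracInt, mul_left_comm _ (1 / Real.Gamma q)]
  rw [intervalIntegral.integral_const_mul, h]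
  field_simp

theorem continuous_add_primitive {A : ℝ → ℝ} (hA : Continuous A) (C : ℝ) :
    Continuous fun s => C + ∫ r in (0:ℝ)..s, A r :=
  continuous_const.add (intervalIntegral.continuous_primitive (fun _ _ => hA.intervalIntegrable _ _) 0)

theorem fracInt_add_primitive {γ t : ℝ} (hγ : 0 < γ) (ht : 0 < t) {A : ℝ → ℝ} (hA : Continuous A)
    (C : ℝ) :
    fracInt γ (fun s => C + ∫ r in (0:ℝ)..s, A r) t =
      C / Real.Gamma (γ + 1) * t ^ γ + ∫ s in (0:ℝ)..t, fracInt γ A s := by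
  have hprim : Continuous fun s => ∫ r in (0:ℝ)..s, A r :=
    intervalIntegral.continuous_primitive (fun _ _ => hA.intervalIntegrable _ _) 0
  rw [fracInt_add (intervalIntegrable_kernel_mul hγ t continuousOn_const)
    (intervalIntegrable_kernel_mul hγ t hprim.continuousOn), fracInt_const C hγ ht]
  congr 1
  rw [← fracInt_one_order (fracInt γ A), fracInt_fracInt one_pos hγ ht.le hA, add_comm,
    ← fracInt_fracInt hγ one_pos ht.le hA]
  exact fracInt_congr ht.le fun s _ => (fracInt_one_order A s).symm

theorem hasDerivAt_primitive_of_continuousOn_Ici {φ : ℝ → ℝ} (hφ : ContinuousOn φ (Ici 0)) {t : ℝ}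
    (ht : 0 < t) : HasDerivAt (fun t => ∫ s in (0:ℝ)..t, φ s) (φ t) t := by
  have hnhds : ∀ᶠ s in nhds t, ContinuousAt φ s := by
    filter_upwards [Ioi_mem_nhds ht] with s hs using hφ.continuousAt (Ici_mem_nhds hs)
  refine intervalIntegral.integral_hasDerivAt_right ?_ ?_ hnhds.self_of_nhds
  · refine (hφ.mono ?_).intervalIntegrable
    rw [uIcc_of_le ht.le]
    exact fun s hs => hs.1
  · exact ContinuousOn.stronglyMeasurableAtFilter isOpen_Ioi (hφ.mono Ioi_subset_Ici_self) t ht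

theorem hasDerivAt_fracInt_add_primitive {γ t : ℝ} (hγ : 0 < γ) (ht : 0 < t) {A : ℝ → ℝ}
    (hA : Continuous A) (C : ℝ) :
    HasDerivAt (fracInt γ (fun s => C + ∫ r in (0:ℝ)..s, A r))
      (C / Real.Gamma γ * t ^ (γ - 1) + fracInt γ A t) t := by
  have h1 := ((Real.hasDerivAt_rpow_const (p := γ) (Or.inl ht.ne')).const_mul
    (C / Real.Gamma (γ + 1))).add
    (hasDerivAt_primitive_of_continuousOn_Ici (continuousOn_fracInt hγ hA) ht)
  have h2 : C / Real.Gamma (γ + 1) * (γ * t ^ (γ - 1)) = C / Real.Gamma γ * t ^ (γ - 1) := by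
    have := (Real.Gamma_pos_of_pos hγ).ne'
    rw [Real.Gamma_add_one hγ.ne']
    field_simp
  rw [h2] at h1
  refine h1.congr_of_eventuallyEq ?_
  filter_upwards [Ioi_mem_nhds ht] with s hs
  exact fracInt_add_primitive hγ hs hA C

theorem hasDerivAt_integral_sub_rpow_mul {p t : ℝ} (hp : 0 ≤ p) (hpt : p < t) (e : ℝ) {f : ℝ → ℝ}
    (hf : ContinuousOn f (Icc 0 p)) :
    HasDerivAt (fun t => ∫ s in (0:ℝ)..p, (t - s) ^ e * f s)
      (∫ s in (0:ℝ)..p, e * (t - s) ^ (e - 1) * f s) t := by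
  obtain ⟨M, hM⟩ := isCompact_Icc.exists_bound_of_continuousOn hf
  set m := (p + t) / 2 with hm
  have hcont : ∀ x, p < x → ∀ e : ℝ, ContinuousOn (fun s => (x - s) ^ e) (Icc 0 p) := by
    intro x hx e
    refine ContinuousOn.rpow_const (by fun_prop) fun s hs => Or.inl ?_
    linarith [hs.2]
  have hKc : ContinuousOn (fun z : ℝ × ℝ => |e * (z.1 - z.2) ^ (e - 1)|)
      (Icc m (t + 1) ×ˢ Icc 0 p) := by
    refine ContinuousOn.abs (continuousOn_const.mul
      (ContinuousOn.rpow_const (by fun_prop) fun z hz => Or.inl ?_))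
    linarith [hz.1.1, hz.2.2]
  obtain ⟨N, hN⟩ := (isCompact_Icc.prod isCompact_Icc).exists_bound_of_continuousOn hKc
  have hII : ∀ g : ℝ → ℝ, ContinuousOn g (Icc 0 p) → IntervalIntegrable g volume 0 p := by
    intro g hg
    exact ContinuousOn.intervalIntegrable (by rwa [uIcc_of_le hp])
  refine (intervalIntegral.hasDerivAt_integral_of_dominated_loc_of_deriv_le
    (F := fun t s => (t - s) ^ e * f s) (F' := fun t s => e * (t - s) ^ (e - 1) * f s)
    (s := Ioo m (t + 1)) (bound := fun _ => N * M) (Ioo_mem_nhds (by linarith) (by linarith))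
    ?_ ?_ ?_ ?_ ?_ ?_).2
  · filter_upwards [Ioi_mem_nhds hpt] with x hx
    exact ((hII _ ((hcont x hx e).mul hf)).def').aestronglyMeasurable
  · exact hII _ ((hcont t hpt e).mul hf)
  · exact ((hII _ ((continuousOn_const.mul (hcont t hpt (e - 1))).mul hf)).def').aestronglyMeasurable
  · refine Eventually.of_forall fun s hs x hx => ?_
    rw [uIoc_of_le hp] at hs
    have h1 := hN (x, s) ⟨⟨hx.1.le, hx.2.le⟩, ⟨hs.1.le, hs.2⟩⟩
    have h2 := hM s ⟨hs.1.le, hs.2⟩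
    rw [Real.norm_eq_abs, abs_abs] at h1
    rw [norm_mul, Real.norm_eq_abs]
    exact mul_le_mul h1 h2 (norm_nonneg _) ((abs_nonneg _).trans h1)
  · exact intervalIntegrable_const
  · refine Eventually.of_forall fun s hs x hx => ?_
    rw [uIoc_of_le hp] at hs
    have hxs : x - s ≠ 0 := by linarith [hx.1, hs.2]
    have := (((hasDerivAt_id x).sub_const s).rpow_const (p := e) (Or.inl hxs)).mul_const (f s)
    simpa using this

theorem abs_integral_sub_rpow_mul_le {p t M e : ℝ} (hp : 0 ≤ p) (hpt : p < t) (he : e ≤ 0)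
    {f : ℝ → ℝ} (hf : ∀ s ∈ Icc 0 p, |f s| ≤ M) :
    |∫ s in (0:ℝ)..p, (t - s) ^ e * f s| ≤ (t - p) ^ e * M * p := by
  have h := intervalIntegral.norm_integral_le_of_norm_le_const (a := 0) (b := p)
    (f := fun s => (t - s) ^ e * f s) (C := (t - p) ^ e * M) ?_
  · simpa [abs_of_nonneg hp] using h
  · intro s hs
    rw [uIoc_of_le hp] at hs
    rw [norm_mul, Real.norm_eq_abs, Real.norm_eq_abs,
      abs_of_nonneg (Real.rpow_nonneg (by linarith [hs.2]) _)]
    refine mul_le_mul ?_ (hf s ⟨hs.1.le, hs.2⟩) (abs_nonneg _)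
      (Real.rpow_nonneg (by linarith) _)
    exact Real.rpow_le_rpow_of_nonpos (by linarith) (by linarith [hs.2]) he

/-- Derivative of a fractional integral of a function that is an antiderivative past `p`: the values
on `[0, p]` contribute through a kernel that is smooth past `p`. -/
theorem hasDerivAt_fracInt_of_eventually_primitive {γ p q t C : ℝ} (hγ : 0 < γ) (hp : 0 ≤ p)
    (ht : t ∈ Ioo p q) {φ A : ℝ → ℝ} (hφ : ContinuousOn φ (Ici 0)) (hA : Continuous A)
    (hφA : ∀ s ∈ Icc p q, φ s = C + ∫ r in (0:ℝ)..s, A r) :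
    HasDerivAt (fracInt γ φ) (C / Real.Gamma γ * t ^ (γ - 1) + fracInt γ A t +
      1 / Real.Gamma γ * ∫ s in (0:ℝ)..p,
        (γ - 1) * (t - s) ^ (γ - 1 - 1) * (φ s - (C + ∫ r in (0:ℝ)..s, A r))) t := by
  have hprim := continuous_add_primitive hA C
  set φ₁ : ℝ → ℝ := fun s => C + ∫ r in (0:ℝ)..s, A r with hφ₁
  have ht0 : 0 < t := hp.trans_lt ht.1
  have h2c : ContinuousOn (fun s => φ s - φ₁ s) (Ici 0) := hφ.sub hprim.continuousOn
  have hd1 := hasDerivAt_fracInt_add_primitive hγ ht0 hA C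
  have hd2 := (hasDerivAt_integral_sub_rpow_mul hp ht.1 (γ - 1)
    (h2c.mono fun s hs => hs.1)).const_mul (1 / Real.Gamma γ)
  refine (hd1.add hd2).congr_of_eventuallyEq ?_
  filter_upwards [Ioo_mem_nhds ht.1 ht.2] with x hx
  have hx0 : 0 < x := hp.trans_lt hx.1
  have hsub : ∀ a b : ℝ, 0 ≤ a → 0 ≤ b → uIcc a b ⊆ Ici 0 := by
    intro a b ha hb s hs
    exact (le_min ha hb).trans hs.1
  have e1 : fracInt γ φ x = fracInt γ φ₁ x + fracInt γ (fun s => φ s - φ₁ s) x := by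
    rw [← fracInt_add (intervalIntegrable_kernel_mul hγ x hprim.continuousOn)
      (intervalIntegrable_kernel_mul hγ x (h2c.mono (hsub _ _ le_rfl hx0.le)))]
    simp
  have e2 : fracInt γ (fun s => φ s - φ₁ s) x =
      1 / Real.Gamma γ * ∫ s in (0:ℝ)..p, (x - s) ^ (γ - 1) * (φ s - φ₁ s) := by
    rw [fracInt, ← intervalIntegral.integral_add_adjacent_intervals (b := p)
      (intervalIntegrable_kernel_mul hγ x (h2c.mono (hsub _ _ le_rfl hp)))
      (intervalIntegrable_kernel_mul hγ x (h2c.mono (hsub _ _ hp hx0.le)))]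
    have : ∫ s in p..x, (x - s) ^ (γ - 1) * (φ s - φ₁ s) = ∫ s in p..x, (0:ℝ) := by
      refine intervalIntegral.integral_congr fun s hs => ?_
      rw [uIcc_of_le hx.1.le] at hs
      simp only [hφA s ⟨hs.1, hs.2.trans hx.2.le⟩, hφ₁, sub_self, mul_zero]
    rw [this]
    simp
  rw [e1, e2]
  rfl

theorem eq_add_primitive_of_hasDerivAt {φ A B : ℝ → ℝ} {p q : ℝ} (hA : Continuous A)
    (hBA : ∀ s ∈ Icc p q, B s = A s) (h : ∀ s ∈ Icc p q, HasDerivAt φ (B s) s) :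
    ∀ s ∈ Icc p q, φ s = φ p - (∫ r in (0:ℝ)..p, A r) + ∫ r in (0:ℝ)..s, A r := by
  intro s hs
  have h1 := intervalIntegral.integral_eq_sub_of_hasDerivAt (a := p) (b := s) (f := φ) (f' := A)
    (fun r hr => by
      rw [uIcc_of_le hs.1] at hr
      have hr' : r ∈ Icc p q := ⟨hr.1, hr.2.trans hs.2⟩
      rw [← hBA r hr']
      exact h r hr') (hA.intervalIntegrable _ _)
  have h2 := intervalIntegral.integral_add_adjacent_intervals (hA.intervalIntegrable 0 p)
    (hA.intervalIntegrable p s) (μ := volume)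
  linarith

/-- Local regularity: where `φ` is `C¹`, its fractional integrals are differentiable. -/
theorem differentiableAt_fracInt {γ t : ℝ} (hγ : 0 < γ) (ht : 0 < t) {φ A : ℝ → ℝ}
    (hφ : ContinuousOn φ (Ici 0)) (hd : ∀ᶠ s in nhds t, HasDerivAt φ (A s) s)
    (hA : ∀ᶠ s in nhds t, ContinuousAt A s) : DifferentiableAt ℝ (fracInt γ φ) t := by
  obtain ⟨ε, hε, hball⟩ := Metric.eventually_nhds_iff.mp
    ((hd.and hA).and (Ioi_mem_nhds ht : ∀ᶠ s in nhds t, s ∈ Ioi (0:ℝ)))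
  have hb : ∀ s ∈ Icc (t - ε / 2) (t + ε / 2), (HasDerivAt φ (A s) s ∧ ContinuousAt A s) ∧ 0 < s :=
    fun s hs => hball (by rw [Real.dist_eq, abs_lt]; constructor <;> linarith [hs.1, hs.2])
  have hle : t - ε / 2 ≤ t + ε / 2 := by linarith
  have hAc : Continuous (IccExtend hle ((Icc (t - ε / 2) (t + ε / 2)).domRestrict A)) := by
    refine Continuous.Icc_extend' (continuousOn_iff_continuous_domRestrict.mp ?_)
    exact fun s hs => (hb s hs).1.2.continuousWithinAt
  have hE : ∀ s ∈ Icc (t - ε / 2) (t + ε / 2),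
      A s = IccExtend hle ((Icc (t - ε / 2) (t + ε / 2)).domRestrict A) s := by
    intro s hs
    rw [IccExtend_of_mem hle _ hs]
    rfl
  exact (hasDerivAt_fracInt_of_eventually_primitive hγ (hb _ (left_mem_Icc.mpr hle)).2.le
    ⟨by linarith, by linarith⟩ hφ hAc
    (eq_add_primitive_of_hasDerivAt hAc hE fun s hs => (hb s hs).1.1)).differentiableAt

/-- A function that is nonpositive before `t₁` and whose fractional integral decreases at a definite
rate up to `t₁` is negative at `t₁`. -/
theorem neg_of_fracInt_decreasing {δ p t₁ m : ℝ} (hδ : 0 < δ) (hδ1 : δ < 1) (hp : 0 ≤ p)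
    (hpt : p < t₁) (hm : 0 < m) {u : ℝ → ℝ} (hkI : IntervalIntegrable u volume 0 p)
    (hneg : ∀ s ∈ Ioo 0 t₁, u s ≤ 0) (hc : ContinuousOn u (Icc p t₁))
    (hU : ∀ s s', p < s → s ≤ s' → s' ≤ t₁ →
      fracInt (1 - δ) u s' - fracInt (1 - δ) u s ≤ -m * (s' - s)) : u t₁ < 0 := by
  have hδ' : 0 < 1 - δ := by linarith
  have hΓ := Real.Gamma_pos_of_pos hδ'
  have hΓδ := Real.Gamma_pos_of_pos hδ
  set L := t₁ - p with hL
  have hL0 : 0 < L := sub_pos.mpr hpt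
  set y : ℝ → ℝ := fun τ => u (p + max 0 (min τ L)) with hy
  have hyc : Continuous y := by
    refine hc.comp_continuous (by fun_prop) fun τ => ⟨?_, ?_⟩
    · linarith [le_max_left 0 (min τ L)]
    · have : max 0 (min τ L) ≤ L := max_le hL0.le (min_le_right _ _)
      linarith
  have hyu : ∀ τ ∈ Icc 0 L, y τ = u (p + τ) := by
    intro τ hτ
    simp only [hy, min_eq_left hτ.2, max_eq_right hτ.1]
  have hyneg : ∀ τ ∈ Ioo 0 L, y τ ≤ 0 := by
    intro τ hτ
    rw [hyu τ ⟨hτ.1.le, hτ.2.le⟩]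
    exact hneg _ ⟨by linarith [hτ.1], by linarith [hτ.2]⟩
  set W := fracInt (1 - δ) y with hW
  have hWc : ContinuousOn W (Ici 0) := continuousOn_fracInt hδ' hyc
  have hkint : ∀ s, p < s → IntervalIntegrable (fun σ => (s - σ) ^ (1 - δ - 1) * u σ) volume 0 p := by
    intro s hs
    refine hkI.continuousOn_mul (ContinuousOn.rpow_const (by fun_prop) fun σ hσ => Or.inl ?_)
    rw [uIcc_of_le hp] at hσ
    linarith [hσ.2]
  have hsplit : ∀ s, p < s → s ≤ t₁ → fracInt (1 - δ) u s =
      1 / Real.Gamma (1 - δ) * (∫ σ in (0:ℝ)..p, (s - σ) ^ (1 - δ - 1) * u σ) + W (s - p) := by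
    intro s hs hst
    have hI2 : IntervalIntegrable (fun σ => (s - σ) ^ (1 - δ - 1) * u σ) volume p s := by
      refine intervalIntegrable_kernel_mul hδ' s (hc.mono ?_)
      rw [uIcc_of_le hs.le]
      exact Icc_subset_Icc_right hst
    rw [fracInt, ← intervalIntegral.integral_add_adjacent_intervals (hkint s hs) hI2, mul_add, hW,
      fracInt]
    congr 2
    have h := intervalIntegral.integral_comp_add_left (a := 0) (b := s - p)
      (fun σ : ℝ => (s - σ) ^ (1 - δ - 1) * u σ) p
    rw [add_zero, add_sub_cancel] at h
    rw [← h]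
    refine intervalIntegral.integral_congr fun τ hτ => ?_
    rw [uIcc_of_le (by linarith)] at hτ
    rw [hyu τ ⟨hτ.1, by linarith [hτ.2]⟩, show s - (p + τ) = s - p - τ by ring]
  have hWdec : ∀ τ r, 0 < τ → 0 ≤ r → τ + r ≤ L → W (τ + r) ≤ W τ - m * r := by
    intro τ r hτ hr hτr
    have h1 := hU (p + τ) (p + τ + r) (by linarith) (by linarith) (by linarith)
    rw [hsplit _ (by linarith) (by linarith), hsplit _ (by linarith) (by linarith)] at h1
    have h2 : ∫ σ in (0:ℝ)..p, (p + τ - σ) ^ (1 - δ - 1) * u σ ≤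
        ∫ σ in (0:ℝ)..p, (p + τ + r - σ) ^ (1 - δ - 1) * u σ := by
      refine intervalIntegral.integral_mono_on_of_le_Ioo hp (hkint _ (by linarith))
        (hkint _ (by linarith)) fun σ hσ => ?_
      refine mul_le_mul_of_nonpos_right ?_ (hneg σ ⟨hσ.1, by linarith [hσ.2]⟩)
      exact Real.rpow_le_rpow_of_nonpos (by linarith [hσ.2]) (by linarith) (by linarith)
    have h3 := mul_le_mul_of_nonneg_left h2 (one_div_pos.mpr hΓ).le
    rw [show p + τ + r - p = τ + r by ring, show p + τ - p = τ by ring] at h1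
    linarith
  have hWneg : ∀ τ ∈ Ioo 0 L, W τ ≤ 0 := by
    intro τ hτ
    rw [hW, fracInt]
    refine mul_nonpos_of_nonneg_of_nonpos (one_div_pos.mpr hΓ).le ?_
    have := intervalIntegral.integral_mono_on_of_le_Ioo (g := fun _ => (0:ℝ)) hτ.1.le
      (intervalIntegrable_kernel_mul hδ' τ (a := 0) hyc.continuousOn) intervalIntegrable_const
      (fun s hs => mul_nonpos_of_nonneg_of_nonpos
        (Real.rpow_nonneg (by linarith [hs.2]) (1 - δ - 1)) (hyneg s ⟨hs.1, hs.2.trans hτ.2⟩))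
    simpa using this
  have hV : ∀ τ, 0 ≤ τ → ∫ s in (0:ℝ)..τ, (τ - s) ^ (δ - 1) * W s =
      Real.Gamma δ * ∫ s in (0:ℝ)..τ, y s := by
    intro τ hτ
    have h := fracInt_fracInt hδ hδ' hτ hyc
    rw [add_sub_cancel, fracInt_one_order] at h
    rw [← h, fracInt]
    field_simp
    rfl
  by_contra! hu
  have hyL : 0 ≤ y L := by rw [hyu L ⟨hL0.le, le_rfl⟩, hL]; simpa using hu
  set ε := m * (L / 2) ^ δ / (2 * δ * Real.Gamma δ) with hε
  have hε0 : 0 < ε := by positivity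
  obtain ⟨η, hη, hηy⟩ := Metric.continuous_iff.mp hyc L ε hε0
  set r := min (η / 2) (L / 2) with hr
  have hr0 : 0 < r := lt_min (by linarith) (by linarith)
  have hrη : r ≤ η / 2 := min_le_left _ _
  have hrL : r ≤ L / 2 := min_le_right _ _
  have hsub : ∀ a b : ℝ, 0 ≤ a → 0 ≤ b → uIcc a b ⊆ Ici 0 := by
    intro a b ha hb s hs
    exact (le_min ha hb).trans hs.1
  have hIW : ∀ τ a b : ℝ, 0 ≤ a → 0 ≤ b →
      IntervalIntegrable (fun s => (τ - s) ^ (δ - 1) * W s) volume a b := fun τ a b ha hb =>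
    intervalIntegrable_kernel_mul hδ τ (hWc.mono (hsub a b ha hb))
  have e1 : ∫ s in (0:ℝ)..r, (L - s) ^ (δ - 1) * W s ≤ 0 := by
    have := intervalIntegral.integral_mono_on_of_le_Ioo (g := fun _ => (0:ℝ)) hr0.le
      (hIW L 0 r le_rfl hr0.le) intervalIntegrable_const
      (fun s hs => mul_nonpos_of_nonneg_of_nonpos
        (Real.rpow_nonneg (by linarith [hs.2]) (δ - 1)) (hWneg s ⟨hs.1, by linarith [hs.2]⟩))
    simpa using this
  have e2 : ∫ s in r..L, (L - s) ^ (δ - 1) * W s ≤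
      (∫ s in (0:ℝ)..(L - r), (L - r - s) ^ (δ - 1) * W s) - m * r * ((L - r) ^ δ / δ) := by
    have h := intervalIntegral.integral_comp_add_right (a := 0) (b := L - r)
      (fun s : ℝ => (L - s) ^ (δ - 1) * W s) r
    rw [zero_add, sub_add_cancel] at h
    have hk : ∫ s in (0:ℝ)..(L - r), (L - r - s) ^ (δ - 1) = (L - r) ^ δ / δ := by
      have h1 := fracInt_const (t := L - r) 1 hδ (by linarith)
      rw [fracInt, Real.Gamma_add_one hδ.ne'] at h1
      simp only [mul_one] at h1
      field_simp at h1 ⊢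
      linarith
    rw [← h, ← hk, ← intervalIntegral.integral_const_mul, ← intervalIntegral.integral_sub
      (hIW _ _ _ le_rfl (by linarith))
      ((intervalIntegrable_sub_rpow hδ (L - r) 0 (L - r)).const_mul _)]
    refine intervalIntegral.integral_mono_on_of_le_Ioo (by linarith) ?_ ?_ fun s hs => ?_
    · have := (hIW L r L hr0.le hL0.le).comp_add_right r
      simpa using this
    · exact (hIW _ _ _ le_rfl (by linarith)).sub
        ((intervalIntegrable_sub_rpow hδ (L - r) 0 (L - r)).const_mul _)
    · rw [show L - (s + r) = L - r - s by ring]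
      have h1 := hWdec s r hs.1 hr0.le (by linarith [hs.2])
      have h2 := mul_le_mul_of_nonneg_left h1
        (Real.rpow_nonneg (by linarith [hs.2] : 0 ≤ L - r - s) (δ - 1))
      linarith
  have e3 := intervalIntegral.integral_add_adjacent_intervals (hIW L 0 r le_rfl hr0.le)
    (hIW L r L hr0.le hL0.le)
  rw [hV L hL0.le] at e3
  rw [hV (L - r) (by linarith)] at e2
  have e4 := intervalIntegral.integral_add_adjacent_intervals
    (hyc.intervalIntegrable 0 (L - r)) (hyc.intervalIntegrable (L - r) L) (μ := volume)
  have e5 : -ε * r ≤ ∫ s in (L - r)..L, y s := by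
    have := intervalIntegral.integral_mono_on (a := L - r) (b := L) (f := fun _ => -ε) (g := y)
      (by linarith) intervalIntegrable_const (hyc.intervalIntegrable _ _) (μ := volume)
      fun s hs => by
        have h1 := hηy s (by rw [Real.dist_eq, abs_lt]; constructor <;> linarith [hs.1, hs.2])
        rw [Real.dist_eq, abs_lt] at h1
        linarith [h1.1]
    rw [intervalIntegral.integral_const] at this
    simp only [sub_sub_cancel, smul_eq_mul] at this
    linarith
  have e6 : (L / 2) ^ δ ≤ (L - r) ^ δ := Real.rpow_le_rpow (by linarith) (by linarith) hδ.le
  have e7 : Real.Gamma δ * (-ε * r) ≤ -(m * r * ((L / 2) ^ δ / δ)) := by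
    have h1 := mul_le_mul_of_nonneg_left e5 hΓδ.le
    have h2 : m * r * ((L / 2) ^ δ / δ) ≤ m * r * ((L - r) ^ δ / δ) := by gcongr
    have h3 : Real.Gamma δ * ∫ s in (L - r)..L, y s =
        Real.Gamma δ * (∫ s in (0:ℝ)..L, y s) - Real.Gamma δ * ∫ s in (0:ℝ)..(L - r), y s := by
      rw [← e4]; ring
    linarith
  have e8 : Real.Gamma δ * (-ε * r) = -(m * r * ((L / 2) ^ δ / δ)) / 2 := by
    rw [hε]
    field_simp
  have e9 : 0 < m * r * ((L / 2) ^ δ / δ) := by positivity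
  linarith

/-- If the fractional integral of order `γ + δ` of `z` has derivative `b` past `T`, then past
`T₀ > T` the fractional integral of order `γ` of `z` is the fractional integral of order `1 - δ` of
a truncation of `b` up to a smooth term whose derivative decays like `t ^ (-1 - δ)`. -/
theorem fracInt_eq_tail_add_decaying {γ δ T T₀ : ℝ} (hγ : 0 < γ) (hδ : 0 < δ) (hδ1 : δ < 1)
    (hT₀ : 0 < T₀) (hT : T < T₀) {z b : ℝ → ℝ} (hz : Continuous z) (hb : ContinuousOn b (Ioi T))
    (hψ : ∀ t > T, HasDerivAt (fracInt (γ + δ) z) (b t) t) :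
    ∃ e e' : ℝ → ℝ, ∃ C : ℝ, 0 ≤ C ∧
      (∀ t > T₀, fracInt γ z t = e t + fracInt (1 - δ) (fun s => b (max s T₀)) t) ∧
      (∀ t > T₀, HasDerivAt e (e' t) t) ∧ ∀ t ≥ T₀ + 1, |e' t| ≤ C * t ^ (-1 - δ) := by
  have hδ' : 0 < 1 - δ := by linarith
  have hΓ := Real.Gamma_pos_of_pos hδ'
  set B : ℝ → ℝ := fun s => b (max s T₀) with hBdef
  have hB : Continuous B := hb.comp_continuous (by fun_prop)
    fun s => hT.trans_le (le_max_right s T₀)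
  set ψ := fracInt (γ + δ) z with hψdef
  have hψc : ContinuousOn ψ (Ici 0) := continuousOn_fracInt (by linarith) hz
  set C₀ := ψ T₀ - ∫ r in (0:ℝ)..T₀, B r with hC₀
  have hprim : ∀ q, ∀ s ∈ Icc T₀ q, ψ s = C₀ + ∫ r in (0:ℝ)..s, B r := fun q =>
    eq_add_primitive_of_hasDerivAt hB
      (fun s hs => by simp only [hBdef, max_eq_left hs.1])
      (fun s hs => hψ s (hT.trans_le hs.1))
  set h : ℝ → ℝ := fun s => ψ s - (C₀ + ∫ r in (0:ℝ)..s, B r) with hh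
  have hhc : ContinuousOn h (Ici 0) := hψc.sub (continuous_add_primitive hB C₀).continuousOn
  have hhc' : ContinuousOn h (Icc 0 T₀) := hhc.mono fun s hs => hs.1
  obtain ⟨M, hM⟩ := isCompact_Icc.exists_bound_of_continuousOn hhc'
  have hM0 : 0 ≤ M := (norm_nonneg _).trans (hM 0 ⟨le_rfl, hT₀.le⟩)
  refine ⟨fun t => C₀ / Real.Gamma (1 - δ) * t ^ (1 - δ - 1) + 1 / Real.Gamma (1 - δ) *
      ((1 - δ - 1) * ∫ s in (0:ℝ)..T₀, (t - s) ^ (1 - δ - 1 - 1) * h s),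
    fun t => C₀ / Real.Gamma (1 - δ) * ((1 - δ - 1) * t ^ (1 - δ - 1 - 1)) +
      1 / Real.Gamma (1 - δ) * ((1 - δ - 1) *
        ∫ s in (0:ℝ)..T₀, (1 - δ - 1 - 1) * (t - s) ^ (1 - δ - 1 - 1 - 1) * h s),
    |C₀| / Real.Gamma (1 - δ) * δ + 1 / Real.Gamma (1 - δ) * (δ * ((1 + δ) *
      ((T₀ + 1) ^ (1 + δ) * M * T₀))), by positivity, fun t ht => ?_, fun t ht => ?_,
    fun t ht => ?_⟩
  · have ht0 : 0 < t := hT₀.trans ht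
    have h1 := hasDerivAt_fracInt_of_eventually_primitive hδ' hT₀.le (q := t + 1)
      ⟨ht, by linarith⟩ hψc hB (hprim (t + 1))
    have h2 : HasDerivAt (fracInt (1 - δ) ψ) (fracInt γ z t) t := by
      refine (hasDerivAt_primitive_of_continuousOn_Ici (continuousOn_fracInt hγ hz)
        ht0).congr_of_eventuallyEq ?_
      filter_upwards [Ioi_mem_nhds ht0] with r hr
      rw [← fracInt_one_order, fracInt_fracInt one_pos hγ (le_of_lt hr) hz, hψdef,
        fracInt_fracInt hδ' (by linarith) (le_of_lt hr) hz]
      congr 1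
      ring
    rw [h2.unique h1]
    simp only [mul_assoc, intervalIntegral.integral_const_mul, hh]
    ring
  · have ht0 : 0 < t := hT₀.trans ht
    exact ((Real.hasDerivAt_rpow_const (Or.inl ht0.ne')).const_mul _).add
      (((hasDerivAt_integral_sub_rpow_mul hT₀.le ht (1 - δ - 1 - 1) hhc').const_mul _).const_mul _)
  · have ht1 : 1 ≤ t - T₀ := by linarith
    have ht0 : 0 < t := by linarith
    have hI : |∫ s in (0:ℝ)..T₀, (1 - δ - 1 - 1) * (t - s) ^ (1 - δ - 1 - 1 - 1) * h s| ≤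
        (1 + δ) * ((T₀ + 1) ^ (1 + δ) * M * T₀ * t ^ (-1 - δ)) := by
      have h1 := abs_integral_sub_rpow_mul_le (e := 1 - δ - 1 - 1 - 1) hT₀.le
        (by linarith : T₀ < t) (by linarith) hM
      simp only [mul_assoc]
      rw [intervalIntegral.integral_const_mul, abs_mul,
        show |1 - δ - 1 - 1| = 1 + δ by rw [abs_of_neg (by linarith)]; ring]
      have h2 : (t - T₀) ^ (1 - δ - 1 - 1 - 1) ≤ (T₀ + 1) ^ (1 + δ) * t ^ (-1 - δ) := by
        calc (t - T₀) ^ (1 - δ - 1 - 1 - 1) ≤ (t - T₀) ^ (-1 - δ) :=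
              Real.rpow_le_rpow_of_exponent_le ht1 (by linarith)
          _ ≤ (t / (T₀ + 1)) ^ (-1 - δ) := by
              refine Real.rpow_le_rpow_of_nonpos (by positivity) ?_ (by linarith)
              rw [div_le_iff₀ (by linarith)]
              nlinarith
          _ = (T₀ + 1) ^ (1 + δ) * t ^ (-1 - δ) := by
              rw [Real.div_rpow ht0.le (by linarith), div_eq_mul_inv, ← Real.rpow_neg (by linarith),
                mul_comm]
              congr 2
              ring
      have h3 : (t - T₀) ^ (1 - δ - 1 - 1 - 1) * M * T₀ ≤
          (T₀ + 1) ^ (1 + δ) * t ^ (-1 - δ) * M * T₀ := by gcongr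
      have h4 : |∫ s in (0:ℝ)..T₀, (t - s) ^ (1 - δ - 1 - 1 - 1) * h s| ≤
          (T₀ + 1) ^ (1 + δ) * (M * (T₀ * t ^ (-1 - δ))) := by linarith
      gcongr
    refine (abs_add_le _ _).trans ?_
    rw [abs_mul, abs_mul, abs_mul, abs_mul, abs_div, abs_of_pos hΓ, abs_of_pos (one_div_pos.mpr hΓ),
      show |1 - δ - 1| = δ by rw [abs_of_neg (by linarith)]; ring, abs_of_nonneg
      (Real.rpow_nonneg ht0.le _), show 1 - δ - 1 - 1 = -1 - δ by ring]
    rw [show 1 - δ - 1 - 1 = -1 - δ by ring] at hI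
    have := mul_le_mul_of_nonneg_left hI (by positivity : 0 ≤ 1 / Real.Gamma (1 - δ) * δ)
    linarith

theorem intervalIntegrable_beta_kernel {p q t : ℝ} (hp : 0 < p) (hq : 0 < q) (ht : 0 < t) :
    IntervalIntegrable (fun s => (t - s) ^ (p - 1) * s ^ (q - 1)) volume 0 t := by
  refine intervalIntegral.intervalIntegrable_of_integral_ne_zero ?_
  have h := fracInt_rpow hp hq ht
  have := Real.Gamma_pos_of_pos hp
  have := Real.Gamma_pos_of_pos hq
  have := Real.Gamma_pos_of_pos (add_pos hp hq)
  intro h0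
  rw [fracInt, h0, mul_zero] at h
  exact (by positivity : Real.Gamma q / Real.Gamma (p + q) * t ^ (p + q - 1) ≠ 0) h.symm

theorem eventually_const_mul_rpow_neg_le {δ ε : ℝ} (hδ : 0 < δ) (hε : 0 < ε) (k : ℝ) :
    ∀ᶠ t in atTop, k * t ^ (-δ) ≤ ε := by
  have h := (tendsto_rpow_neg_atTop hδ).const_mul k
  rw [mul_zero] at h
  exact h.eventually_le_const hε

set_option maxHeartbeats 1000000 in
/-- Barrier argument: if past `T` either `a * b` is below `-c * t ^ (-ρ)`, or `A + a * b` is, where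
`A` is locally the derivative of the fractional integral whose integral of order `δ` has
derivative `b`, then `b` itself eventually stays below a negative multiple of `t ^ (-ρ)`. -/
theorem eventually_le_neg_rpow_of_zones {γ δ a c ρ T : ℝ} (hγ : 0 < γ) (hδ : 0 < δ) (hδ1 : δ < 1)
    (ha : 0 < a) (hc : 0 < c) (hρ : 0 < ρ) (hρ1 : ρ < 1) {z b A : ℝ → ℝ} (hz : Continuous z)
    (hb : ContinuousOn b (Ioi T)) (hA : ContinuousOn A (Ioi T))
    (hψ : ∀ t > T, HasDerivAt (fracInt (γ + δ) z) (b t) t)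
    (hzone : ∀ t > T, a * b t ≤ -c * t ^ (-ρ) ∨
      (A t + a * b t ≤ -c * t ^ (-ρ) ∧ ∀ᶠ s in nhds t, HasDerivAt (fracInt γ z) (A s) s)) :
    ∀ᶠ t in atTop, b t ≤ -(c / (4 * a)) * t ^ (-ρ) := by
  have hδ' : 0 < 1 - δ := by linarith
  set κ := (1 + ρ) / 2 with hκ
  have hρκ : ρ < κ := by linarith
  have hκ1 : κ < 1 := by linarith
  have hκ0 : 0 < κ := hρ.trans hρκ
  set c₁ := c / (2 * a) with hc₁
  have hc₁0 : 0 < c₁ := by positivity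
  set k₁ := Real.Gamma (1 - κ) / Real.Gamma (1 - δ + (1 - κ)) with hk₁
  set k₂ := Real.Gamma (1 - ρ) / Real.Gamma (1 - δ + (1 - ρ)) with hk₂
  have hk₁0 : 0 < k₁ :=
    div_pos (Real.Gamma_pos_of_pos (by linarith)) (Real.Gamma_pos_of_pos (by linarith))
  have hk₂0 : 0 < k₂ :=
    div_pos (Real.Gamma_pos_of_pos (by linarith)) (Real.Gamma_pos_of_pos (by linarith))
  obtain ⟨T₀, ⟨⟨hT₀a, hT₀c⟩, hT₀T⟩, hT₀1⟩ :=
    (((eventually_const_mul_rpow_neg_le hδ (half_pos ha) k₁).and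
      (eventually_const_mul_rpow_neg_le hδ (by positivity : 0 < c / 8) (c₁ * k₂))).and
      (eventually_gt_atTop T)).and (eventually_gt_atTop 1) |>.exists
  have hT₀ : 0 < T₀ := by linarith
  obtain ⟨e, e', C, hC, hdec, he, he'⟩ := fracInt_eq_tail_add_decaying hγ hδ hδ1 hT₀ hT₀T hz hb hψ
  set B : ℝ → ℝ := fun s => b (max s T₀) with hBdef
  have hB : Continuous B := hb.comp_continuous (by fun_prop)
    fun s => hT₀T.trans_le (le_max_right s T₀)
  obtain ⟨M, hM⟩ := (isCompact_Icc (a := 0) (b := T₀ + 1)).exists_bound_of_continuousOn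
    hB.continuousOn
  have hM0 : 0 ≤ M := (norm_nonneg _).trans (hM 0 ⟨le_rfl, by linarith⟩)
  set K := 2 * C / a + 2 * ((M + 1) * (T₀ + 1) ^ κ) + 2 * (c₁ * (T₀ + 1) ^ (κ - ρ)) with hK
  have hK0 : 0 < K := by positivity
  have hK1 : C ≤ K * a / 2 := by
    have : 2 * C / a ≤ K := by rw [hK, add_assoc]; exact le_add_of_nonneg_right (by positivity)
    rw [div_le_iff₀ ha] at this
    linarith
  have hK2 : (M + 1) * (T₀ + 1) ^ κ ≤ K / 2 := by
    have h1 : 0 ≤ 2 * C / a := by positivity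
    have h2 : 0 ≤ c₁ * (T₀ + 1) ^ (κ - ρ) := by positivity
    linarith
  have hK3 : c₁ * (T₀ + 1) ^ (κ - ρ) ≤ K / 2 := by
    have h1 : 0 ≤ 2 * C / a := by positivity
    have h2 : 0 ≤ (M + 1) * (T₀ + 1) ^ κ := by positivity
    linarith
  set v : ℝ → ℝ := fun s => K * s ^ (-κ) - c₁ * s ^ (-ρ) with hv
  set V : ℝ → ℝ := fun s => K * k₁ * s ^ (1 - δ - κ) - c₁ * k₂ * s ^ (1 - δ - ρ) with hV
  have hkI : ∀ ρ < (1:ℝ), ∀ t > 0,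
      IntervalIntegrable (fun s => (t - s) ^ (1 - δ - 1) * s ^ (-ρ)) volume 0 t := by
    intro ρ hρ t ht
    have := intervalIntegrable_beta_kernel hδ' (by linarith : 0 < 1 - ρ) ht
    rwa [show 1 - ρ - 1 = -ρ by ring] at this
  have hpow : ∀ ρ < (1:ℝ), ∀ t > 0, fracInt (1 - δ) (fun s => s ^ (-ρ)) t =
      Real.Gamma (1 - ρ) / Real.Gamma (1 - δ + (1 - ρ)) * t ^ (1 - δ - ρ) := by
    intro ρ hρ t ht
    have := fracInt_rpow hδ' (by linarith : 0 < 1 - ρ) ht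
    rw [show 1 - ρ - 1 = -ρ by ring] at this
    rw [this]
    congr 2
    ring
  have hvI : ∀ t > 0, IntervalIntegrable (fun s => (t - s) ^ (1 - δ - 1) * v s) volume 0 t := by
    intro t ht
    refine (((hkI κ hκ1 t ht).const_mul K).sub ((hkI ρ hρ1 t ht).const_mul c₁)).congr ?_
    intro s _
    simp only [hv]
    ring
  have hvV : ∀ t > 0, fracInt (1 - δ) v t = V t := by
    intro t ht
    have h := fracInt_sub (γ := 1 - δ) (t := t) (f := fun s => K * s ^ (-κ))
      (g := fun s => c₁ * s ^ (-ρ))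
      (((hkI κ hκ1 t ht).const_mul K).congr fun s _ => by ring)
      (((hkI ρ hρ1 t ht).const_mul c₁).congr fun s _ => by ring)
    rw [hv, h, fracInt_const_mul, fracInt_const_mul, hpow κ hκ1 t ht, hpow ρ hρ1 t ht, hV]
    simp only [mul_assoc, hk₁, hk₂]
  set u : ℝ → ℝ := fun s => B s - v s with hu
  have hFu : ∀ t > T₀, fracInt (1 - δ) u t = fracInt γ z t - e t - V t := by
    intro t ht
    rw [hu, fracInt_sub (intervalIntegrable_kernel_mul hδ' t hB.continuousOn)
      (hvI t (hT₀.trans ht)), hvV t (hT₀.trans ht), hdec t ht]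
    ring
  have hvc : ContinuousOn v (Ioi 0) := by
    refine ContinuousOn.sub ?_ ?_ <;>
    exact continuousOn_const.mul (continuousOn_id.rpow_const fun s hs => Or.inl (ne_of_gt hs))
  have hsmall : ∀ s ∈ Ioc 0 (T₀ + 1), u s < 0 := by
    intro s hs
    have h1 := (abs_le.mp (hM s ⟨hs.1.le, hs.2⟩)).2
    have h2 : c₁ * s ^ (-ρ) ≤ K / 2 * s ^ (-κ) := by
      have : s ^ (-ρ) = s ^ (κ - ρ) * s ^ (-κ) := by
        rw [← Real.rpow_add hs.1]; congr 1; ring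
      rw [this, ← mul_assoc]
      refine mul_le_mul_of_nonneg_right (le_trans ?_ hK3) (Real.rpow_nonneg hs.1.le _)
      exact mul_le_mul_of_nonneg_left (Real.rpow_le_rpow hs.1.le hs.2 (by linarith)) hc₁0.le
    have h3 : M + 1 ≤ K / 2 * s ^ (-κ) := by
      calc M + 1 = (M + 1) * (T₀ + 1) ^ κ * (T₀ + 1) ^ (-κ) := by
            rw [mul_assoc, ← Real.rpow_add (by linarith)]; simp
        _ ≤ K / 2 * (T₀ + 1) ^ (-κ) := by gcongr
        _ ≤ K / 2 * s ^ (-κ) := mul_le_mul_of_nonneg_left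
            (Real.rpow_le_rpow_of_nonpos hs.1 hs.2 (by linarith)) (by positivity)
    simp only [hu, hv]
    linarith
  have hlt : ∀ t ≥ T₀ + 1, b t < v t := by
    by_contra! hex
    set S := {t | T₀ + 1 ≤ t ∧ 0 ≤ u t} with hS
    have hucI : ContinuousOn u (Ici (T₀ + 1)) :=
      hB.continuousOn.sub (hvc.mono fun s (hs : T₀ + 1 ≤ s) => by
        show 0 < s
        linarith)
    have hSc : IsClosed S := hucI.preimage_isClosed_of_isClosed isClosed_Ici isClosed_Ici
    have hSb : BddBelow S := ⟨T₀ + 1, fun t ht => ht.1⟩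
    have hBb : ∀ t ≥ T₀, B t = b t := fun t ht => by simp only [hBdef, max_eq_left ht]
    have hSn : S.Nonempty := by
      obtain ⟨t, ht, hvt⟩ := hex
      refine ⟨t, ht, ?_⟩
      simp only [hu, hBb t (by linarith)]
      linarith
    have hmem := hSc.csInf_mem hSn hSb
    set t₁ := sInf S with ht₁
    obtain ⟨hge, hu1⟩ := hmem
    have hgt : T₀ + 1 < t₁ := by
      refine lt_of_le_of_ne hge fun h => ?_
      exact absurd (hsmall t₁ ⟨by linarith, h.symm.le⟩) (not_lt.mpr hu1)
    have hneg : ∀ s ∈ Ioo 0 t₁, u s < 0 := by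
      intro s hs
      rcases le_or_gt s (T₀ + 1) with h | h
      · exact hsmall s ⟨hs.1, h⟩
      · by_contra! hs0
        exact absurd (csInf_le hSb ⟨h.le, hs0⟩) (not_le.mpr hs.2)
    have ht₁0 : 0 < t₁ := by linarith
    have hbv : v t₁ ≤ b t₁ := by
      have : 0 ≤ B t₁ - v t₁ := hu1
      rw [hBb t₁ (by linarith)] at this
      linarith
    have hav : a * v t₁ = a * K * t₁ ^ (-κ) - c / 2 * t₁ ^ (-ρ) := by
      simp only [hv, hc₁]
      field_simp
    have hpκ : 0 < t₁ ^ (-κ) := Real.rpow_pos_of_pos ht₁0 _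
    have hpρ : 0 < t₁ ^ (-ρ) := Real.rpow_pos_of_pos ht₁0 _
    have havb := mul_le_mul_of_nonneg_left hbv ha.le
    have haK : 0 < a * K * t₁ ^ (-κ) := by positivity
    rcases hzone t₁ (by linarith) with h1 | ⟨h1, hd⟩
    · have : 0 < c * t₁ ^ (-ρ) := by positivity
      linarith
    set G : ℝ → ℝ := fun s => A s + C * s ^ (-1 - δ) + K * k₁ * s ^ (1 - δ - κ - 1) +
      c₁ * k₂ * s ^ (1 - δ - ρ - 1) with hG
    have hTt : T₀ ^ (-δ) ≥ t₁ ^ (-δ) :=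
      Real.rpow_le_rpow_of_nonpos hT₀ (by linarith) (by linarith)
    have hG1 : C * t₁ ^ (-1 - δ) ≤ K * a / 2 * t₁ ^ (-κ) := by
      have : t₁ ^ (-1 - δ) ≤ t₁ ^ (-κ) :=
        Real.rpow_le_rpow_of_exponent_le (by linarith) (by linarith)
      gcongr
    have hG2 : K * k₁ * t₁ ^ (1 - δ - κ - 1) ≤ K * a / 2 * t₁ ^ (-κ) := by
      have h2 : t₁ ^ (1 - δ - κ - 1) = t₁ ^ (-δ) * t₁ ^ (-κ) := by
        rw [← Real.rpow_add ht₁0]; congr 1; ring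
      have h3 : k₁ * t₁ ^ (-δ) ≤ a / 2 := by
        have : k₁ * t₁ ^ (-δ) ≤ k₁ * T₀ ^ (-δ) := by gcongr
        linarith
      have h4 : K * (k₁ * t₁ ^ (-δ)) * t₁ ^ (-κ) ≤ K * (a / 2) * t₁ ^ (-κ) := by gcongr
      rw [h2]
      linarith
    have hG3 : c₁ * k₂ * t₁ ^ (1 - δ - ρ - 1) ≤ c / 8 * t₁ ^ (-ρ) := by
      have h2 : t₁ ^ (1 - δ - ρ - 1) = t₁ ^ (-δ) * t₁ ^ (-ρ) := by
        rw [← Real.rpow_add ht₁0]; congr 1; ring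
      have h3 : c₁ * k₂ * t₁ ^ (-δ) ≤ c / 8 := by
        have : c₁ * k₂ * t₁ ^ (-δ) ≤ c₁ * k₂ * T₀ ^ (-δ) := by gcongr
        linarith
      rw [h2, ← mul_assoc]
      gcongr
    have hGneg : G t₁ < 0 := by
      have : 0 < c * t₁ ^ (-ρ) := by positivity
      simp only [hG]
      linarith
    have hGc : ContinuousAt G t₁ := by
      have hAc := hA.continuousAt (Ioi_mem_nhds (by linarith : T < t₁))
      have hr : ∀ r : ℝ, ContinuousAt (fun s : ℝ => s ^ r) t₁ := fun r =>
        Real.continuousAt_rpow_const _ _ (Or.inl ht₁0.ne')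
      exact ((hAc.add ((hr _).const_mul _)).add ((hr _).const_mul _)).add ((hr _).const_mul _)
    have hGm : ∀ᶠ s in nhds t₁, G s < G t₁ / 2 :=
      hGc.eventually (gt_mem_nhds (by linarith))
    obtain ⟨ε, hε, hball⟩ := Metric.eventually_nhds_iff.mp (hGm.and hd)
    set p := max (T₀ + 1) (t₁ - ε / 2) with hp
    have hpt : p < t₁ := max_lt hgt (by linarith)
    have hpT : T₀ + 1 ≤ p := le_max_left _ _
    have hpε : t₁ - ε / 2 ≤ p := le_max_right _ _
    have hder : ∀ s ∈ Icc p t₁, ∃ d ≤ -(-G t₁ / 2), HasDerivAt (fracInt (1 - δ) u) d s := by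
      intro s hs
      obtain ⟨hGs, hds⟩ := hball (y := s)
        (by rw [Real.dist_eq, abs_lt]; constructor <;> linarith [hs.1, hs.2])
      have hs0 : 0 < s := by linarith [hs.1]
      have hsT : T₀ < s := by linarith [hs.1]
      have hdV : HasDerivAt V (K * k₁ * ((1 - δ - κ) * s ^ (1 - δ - κ - 1)) -
          c₁ * k₂ * ((1 - δ - ρ) * s ^ (1 - δ - ρ - 1))) s :=
        ((Real.hasDerivAt_rpow_const (Or.inl hs0.ne')).const_mul _).sub
          ((Real.hasDerivAt_rpow_const (Or.inl hs0.ne')).const_mul _)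
      refine ⟨_, ?_, ((hds.sub (he s hsT)).sub hdV).congr_of_eventuallyEq ?_⟩
      · have h2 := (abs_le.mp (he' s (by linarith [hs.1]))).1
        have h3 : 0 ≤ K * k₁ * s ^ (1 - δ - κ - 1) := by positivity
        have h4 : 0 ≤ c₁ * k₂ * s ^ (1 - δ - ρ - 1) := by positivity
        simp only [hG] at hGs ⊢
        have h5 := mul_nonneg h3 (by linarith : 0 ≤ 1 + (1 - δ - κ))
        have h6 := mul_nonneg h4 (by linarith : 0 ≤ 1 - (1 - δ - ρ))
        linarith
      · filter_upwards [Ioi_mem_nhds hsT] with r hr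
        exact hFu r hr
    have hfin := neg_of_fracInt_decreasing (m := -G t₁ / 2) hδ hδ1 (by linarith : 0 ≤ p) hpt
      (by linarith) (u := u) ?_ (fun s hs => (hneg s hs).le)
      (hucI.mono fun s hs => hpT.trans hs.1) ?_
    · exact absurd hfin (not_lt.mpr hu1)
    · refine (hB.intervalIntegrable _ _).sub
        (((intervalIntegral.intervalIntegrable_rpow' (by linarith)).const_mul K).sub
          ((intervalIntegral.intervalIntegrable_rpow' (by linarith)).const_mul c₁))
    · intro s s' hs hss' hs'
      refine (convex_Icc p t₁).image_sub_le_mul_sub_of_deriv_le (fun r hr => ?_) (fun r hr => ?_)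
        (fun r hr => ?_) s ⟨hs.le, hss'.trans hs'⟩ s' ⟨hs.le.trans hss', hs'⟩ hss'
      · obtain ⟨d, _, h⟩ := hder r hr
        exact h.continuousAt.continuousWithinAt
      · obtain ⟨d, _, h⟩ := hder r (interior_subset hr)
        exact h.differentiableAt.differentiableWithinAt
      · obtain ⟨d, h', h⟩ := hder r (interior_subset hr)
        rw [h.deriv]
        exact h'
  filter_upwards [eventually_ge_atTop (T₀ + 1),
    eventually_const_mul_rpow_neg_le (by linarith : 0 < κ - ρ) (half_pos hc₁0) K] with t ht hKt
  have ht0 : 0 < t := by linarith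
  have h1 := hlt t ht
  have h2 : t ^ (-κ) = t ^ (-(κ - ρ)) * t ^ (-ρ) := by
    rw [← Real.rpow_add ht0]; congr 1; ring
  have h3 := mul_le_mul_of_nonneg_right hKt (Real.rpow_nonneg ht0.le (-ρ))
  have h4 : c / (4 * a) = c₁ / 2 := by rw [hc₁]; field_simp; norm_num
  simp only [hv, h2] at h1
  rw [h4]
  linarith

theorem continuous_iteratedDerivWithin_max {w : ℝ → ℝ} {m k : ℕ}
    (hw : ContDiffOn ℝ m w (Ici 0)) (hk : k ≤ m) :
    Continuous fun s => iteratedDerivWithin k w (Ici 0) (max s 0) :=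
  (hw.continuousOn_iteratedDerivWithin (by exact_mod_cast hk)
    (uniqueDiffOn_Ici 0)).comp_continuous (by fun_prop) fun s => le_max_right s 0

theorem iteratedDerivWithin_eq_add_primitive {w : ℝ → ℝ} {m k : ℕ}
    (hw : ContDiffOn ℝ m w (Ici 0)) (hk : k < m) {s : ℝ} (hs : 0 ≤ s) :
    iteratedDerivWithin k w (Ici 0) s = iteratedDerivWithin k w (Ici 0) 0 +
      ∫ r in (0:ℝ)..s, iteratedDerivWithin (k + 1) w (Ici 0) (max r 0) := by
  have h := intervalIntegral.integral_eq_sub_of_hasDerivAt_of_le hs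
    (f := iteratedDerivWithin k w (Ici 0))
    (f' := fun r => iteratedDerivWithin (k + 1) w (Ici 0) (max r 0)) ?_ (fun r hr => ?_)
    ((continuous_iteratedDerivWithin_max hw hk).intervalIntegrable _ _)
  · linarith
  · exact (hw.continuousOn_iteratedDerivWithin (by exact_mod_cast hk.le)
      (uniqueDiffOn_Ici 0)).mono fun r hr => hr.1
  · rw [max_eq_left hr.1.le, iteratedDerivWithin_succ]
    exact ((hw.differentiableOn_iteratedDerivWithin (by exact_mod_cast hk)
      (uniqueDiffOn_Ici 0) r hr.1.le).hasDerivWithinAt).hasDerivAt (Ici_mem_nhds hr.1)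

theorem hasDerivAt_fracInt_iteratedDerivWithin {γ t : ℝ} (hγ : 0 < γ) (ht : 0 < t) {w : ℝ → ℝ}
    {m k : ℕ} (hw : ContDiffOn ℝ m w (Ici 0)) (hk : k < m) :
    HasDerivAt (fracInt γ fun s => iteratedDerivWithin k w (Ici 0) (max s 0))
      (iteratedDerivWithin k w (Ici 0) 0 / Real.Gamma γ * t ^ (γ - 1) +
        fracInt γ (fun s => iteratedDerivWithin (k + 1) w (Ici 0) (max s 0)) t) t := by
  refine (hasDerivAt_fracInt_add_primitive hγ ht (continuous_iteratedDerivWithin_max hw hk)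
    (iteratedDerivWithin k w (Ici 0) 0)).congr_of_eventuallyEq ?_
  filter_upwards [Ioi_mem_nhds ht] with r hr
  refine fracInt_congr (le_of_lt hr) fun s hs => ?_
  rw [max_eq_left hs.1]
  exact iteratedDerivWithin_eq_add_primitive hw hk hs.1

theorem hasDerivAt_sum_rpow {γ t : ℝ} (ht : 0 < t) (k : ℕ) (e : ℕ → ℝ) :
    HasDerivAt (fun t : ℝ => ∑ j ∈ Finset.range k, e j * t ^ (γ - 1 - j))
      (∑ j ∈ Finset.range k, e j * ((γ - 1 - j) * t ^ (γ - 1 - j - 1))) t :=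
  HasDerivAt.fun_sum fun _ _ => (Real.hasDerivAt_rpow_const (Or.inl ht.ne')).const_mul _

theorem abs_sum_deriv_rpow_le {γ t : ℝ} (ht : 1 ≤ t) (k : ℕ) (e : ℕ → ℝ) :
    |∑ j ∈ Finset.range k, e j * ((γ - 1 - j) * t ^ (γ - 1 - j - 1))| ≤
      (∑ j ∈ Finset.range k, |e j| * |γ - 1 - j|) * t ^ (γ - 2) := by
  rw [Finset.sum_mul]
  refine (Finset.abs_sum_le_sum_abs _ _).trans (Finset.sum_le_sum fun j _ => ?_)
  rw [abs_mul, abs_mul, abs_of_nonneg (Real.rpow_nonneg (by linarith : 0 ≤ t) _), mul_assoc]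
  refine mul_le_mul_of_nonneg_left (mul_le_mul_of_nonneg_left
    (Real.rpow_le_rpow_of_exponent_le ht ?_) (abs_nonneg _)) (abs_nonneg _)
  linarith [(Nat.cast_nonneg j : (0:ℝ) ≤ j)]

theorem continuousOn_sum_deriv_rpow {γ : ℝ} (k : ℕ) (e : ℕ → ℝ) :
    ContinuousOn (fun t : ℝ => ∑ j ∈ Finset.range k, e j * ((γ - 1 - j) * t ^ (γ - 1 - j - 1)))
      (Ioi 0) := by
  refine continuousOn_finsetSum _ fun j _ => continuousOn_const.mul (continuousOn_const.mul ?_)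
  exact continuousOn_id.rpow_const fun s hs => Or.inl (ne_of_gt hs)

/-- Derivatives of a fractional integral: differentiate under the integral, up to negative powers
coming from the initial values. -/
theorem iteratedDeriv_fracInt {γ : ℝ} (hγ : 0 < γ) {w : ℝ → ℝ} {m k : ℕ}
    (hw : ContDiffOn ℝ m w (Ici 0)) (hk : k ≤ m) :
    ∃ e : ℕ → ℝ, ∀ t > 0, iteratedDeriv k (fracInt γ w) t =
      fracInt γ (fun s => iteratedDerivWithin k w (Ici 0) (max s 0)) t +
        ∑ j ∈ Finset.range k, e j * t ^ (γ - 1 - j) := by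
  induction k with
  | zero =>
    refine ⟨0, fun t ht => ?_⟩
    simp only [iteratedDeriv_zero, iteratedDerivWithin_zero, Finset.range_zero, Finset.sum_empty,
      add_zero]
    exact fracInt_congr ht.le fun s hs => by rw [max_eq_left hs.1]
  | succ k ih =>
    obtain ⟨e, he⟩ := ih (by omega)
    refine ⟨fun j => Nat.casesOn j (iteratedDerivWithin k w (Ici 0) 0 / Real.Gamma γ)
      fun i => e i * (γ - 1 - i), fun t ht => ?_⟩
    have hd := (hasDerivAt_fracInt_iteratedDerivWithin hγ ht hw hk).add
      (hasDerivAt_sum_rpow (γ := γ) ht k e)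
    rw [iteratedDeriv_succ, (hd.congr_of_eventuallyEq ?_).deriv, Finset.sum_range_succ']
    · change _ = _ + (∑ j ∈ Finset.range k, e j * (γ - 1 - j) * t ^ (γ - 1 - ((j + 1 : ℕ) : ℝ)) +
        iteratedDerivWithin k w (Ici 0) 0 / Real.Gamma γ * t ^ (γ - 1 - ((0 : ℕ) : ℝ)))
      have : ∀ j : ℕ, e j * ((γ - 1 - j) * t ^ (γ - 1 - j - 1)) =
          e j * (γ - 1 - j) * t ^ (γ - 1 - ((j + 1 : ℕ) : ℝ)) := by
        intro j
        rw [mul_assoc]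
        congr 3
        push_cast
        ring
      simp only [this, Nat.cast_zero, sub_zero]
      ring
    · filter_upwards [Ioi_mem_nhds ht] with r hr using he r hr

theorem differentiableAt_iteratedDeriv_fracInt {γ t : ℝ} (hγ : 0 < γ) (ht : 0 < t) {w : ℝ → ℝ}
    {m k : ℕ} (hw : ContDiffOn ℝ m w (Ici 0)) (hk : k < m) :
    DifferentiableAt ℝ (iteratedDeriv k (fracInt γ w)) t := by
  obtain ⟨e, he⟩ := iteratedDeriv_fracInt hγ hw hk.le
  refine (((hasDerivAt_fracInt_iteratedDerivWithin hγ ht hw hk).add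
    (hasDerivAt_sum_rpow (γ := γ) ht k e)).congr_of_eventuallyEq ?_).differentiableAt
  filter_upwards [Ioi_mem_nhds ht] with r hr using he r hr

theorem eventually_abs_sum_deriv_rpow_le {γ ρ ε : ℝ} (hγ : γ < 1) (hρ : ρ < 1) (hε : 0 < ε)
    (k : ℕ) (e : ℕ → ℝ) :
    ∀ᶠ t : ℝ in atTop, |∑ j ∈ Finset.range k, e j * ((γ - 1 - j) * t ^ (γ - 1 - j - 1))| ≤
      ε * t ^ (-ρ) := by
  filter_upwards [eventually_const_mul_rpow_neg_le (by linarith : 0 < 2 - γ - ρ) hε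
    (∑ j ∈ Finset.range k, |e j| * |γ - 1 - j|), eventually_ge_atTop 1] with t h1 h2
  have ht0 : 0 < t := by linarith
  refine (abs_sum_deriv_rpow_le h2 k e).trans ?_
  rw [show γ - 2 = -(2 - γ - ρ) + -ρ by ring, Real.rpow_add ht0, ← mul_assoc]
  exact mul_le_mul_of_nonneg_right h1 (Real.rpow_nonneg ht0.le _)

/-- Integrating an eventual power bound on the derivative. -/
theorem eventually_le_neg_rpow_of_deriv {G : ℝ → ℝ} {c e : ℝ} (hc : 0 < c) (he : -1 < e)
    (hd : ∀ᶠ t in atTop, DifferentiableAt ℝ G t) (hG : ∀ᶠ t in atTop, deriv G t ≤ -c * t ^ e) :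
    ∃ c' > 0, ∀ᶠ t in atTop, G t ≤ -c' * t ^ (e + 1) := by
  obtain ⟨T, hT⟩ := eventually_atTop.mp ((hd.and hG).and (eventually_gt_atTop 0))
  have he1 : 0 < e + 1 := by linarith
  set k := c / (e + 1) with hk
  have hder : ∀ t ≥ T, HasDerivAt (fun t => G t + k * t ^ (e + 1))
      (deriv G t + k * ((e + 1) * t ^ (e + 1 - 1))) t := fun t ht =>
    (hT t ht).1.1.hasDerivAt.add
      ((Real.hasDerivAt_rpow_const (Or.inl (hT t ht).2.ne')).const_mul _)
  have hanti : AntitoneOn (fun t => G t + k * t ^ (e + 1)) (Ici T) := by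
    refine antitoneOn_of_deriv_nonpos (convex_Ici T)
      (fun t ht => (hder t ht).continuousAt.continuousWithinAt)
      (fun t ht => (hder t (interior_subset ht)).differentiableAt.differentiableWithinAt)
      fun t ht => ?_
    have ht' : T ≤ t := interior_subset ht
    rw [(hder t ht').deriv, add_sub_cancel_right, ← mul_assoc, hk, div_mul_cancel₀ _ he1.ne']
    linarith [(hT t ht').1.2]
  refine ⟨k / 2, by positivity, ?_⟩
  filter_upwards [eventually_const_mul_rpow_neg_le he1 (by positivity : 0 < k / 2)
    (G T + k * T ^ (e + 1)), eventually_ge_atTop T] with t h1 h2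
  have ht0 := (hT t h2).2
  have h3 := hanti self_mem_Ici h2 h2
  have h4 := mul_le_mul_of_nonneg_right h1 (Real.rpow_nonneg ht0.le (e + 1))
  rw [mul_assoc, ← Real.rpow_add ht0, neg_add_cancel, Real.rpow_zero] at h4
  simp only at h3
  linarith

theorem neg_mul_rpow_le_fracInt {γ t D : ℝ} (hγ : 0 < γ) (ht : 0 < t) {w : ℝ → ℝ}
    (hw : ContinuousOn w (Icc 0 t)) (hD : ∀ s ∈ Icc 0 t, -D ≤ w s) :
    -D / Real.Gamma (γ + 1) * t ^ γ ≤ fracInt γ w t := by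
  rw [← fracInt_const _ hγ ht, fracInt, fracInt]
  refine mul_le_mul_of_nonneg_left ?_ (one_div_pos.mpr (Real.Gamma_pos_of_pos hγ)).le
  refine intervalIntegral.integral_mono_on ht.le
    (intervalIntegrable_kernel_mul hγ t continuousOn_const)
    (intervalIntegrable_kernel_mul hγ t (by rwa [uIcc_of_le ht.le])) fun s hs => ?_
  exact mul_le_mul_of_nonneg_left (hD s hs) (Real.rpow_nonneg (by linarith [hs.2]) _)

/-- If `D^(m+1) I^γ₁ w + a D^(m+1) I^γ₂ w` is eventually below a negative multiple of `t ^ (-ρ)`,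
then so is the lower-order term `D^(m+1) I^γ₂ w` alone. -/
theorem eventually_iteratedDeriv_fracInt_le {γ₁ γ₂ ρ a c T : ℝ} {m : ℕ} (hγ₁ : 0 ≤ γ₁)
    (hγ : γ₁ < γ₂) (hγ₂ : γ₂ < 1) (hρ : 0 < ρ) (hρ1 : ρ < 1) (ha : 0 < a) (hc : 0 < c)
    (hT : 0 ≤ T) {w h : ℝ → ℝ} (hw : ContDiffOn ℝ m w (Ici 0)) (hh : ContinuousOn h (Ioi T))
    (hA : ContinuousOn (iteratedDeriv (m + 1) (fracInt γ₁ w)) (Ioi T))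
    (heq : ∀ t > T, iteratedDeriv (m + 1) (fracInt γ₁ w) t +
      a * iteratedDeriv (m + 1) (fracInt γ₂ w) t = h t)
    (hle : ∀ t > T, h t ≤ -c * t ^ (-ρ)) :
    ∃ c' > 0, ∀ᶠ t in atTop, iteratedDeriv (m + 1) (fracInt γ₂ w) t ≤ -c' * t ^ (-ρ) := by
  set A := iteratedDeriv (m + 1) (fracInt γ₁ w) with hAdef
  set Bd := iteratedDeriv (m + 1) (fracInt γ₂ w) with hBdef
  have hBc : ContinuousOn Bd (Ioi T) := by
    refine ((hh.sub hA).div_const a).congr fun t ht => ?_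
    rw [eq_div_iff ha.ne', Pi.sub_apply, ← heq t ht]
    ring
  rcases hγ₁.eq_or_lt with h0 | hγ₁
  · refine ⟨c / a, by positivity, ?_⟩
    filter_upwards [eventually_gt_atTop T] with t ht
    have hz : fracInt γ₁ w = fun _ => 0 := by
      funext s
      rw [← h0, fracInt_zero_order]
    have hA0 : A t = 0 := by
      rw [hAdef, hz, iteratedDeriv_const]
      simp
    have h1 := hle t ht
    rw [← heq t ht, hA0, zero_add] at h1
    rw [neg_mul, div_mul_eq_mul_div, ← neg_div, le_div_iff₀ ha]
    linarith
  have hγ₂0 : 0 < γ₂ := hγ₁.trans hγ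
  obtain ⟨e₁, he₁⟩ := iteratedDeriv_fracInt hγ₁ hw le_rfl
  obtain ⟨e₂, he₂⟩ := iteratedDeriv_fracInt hγ₂0 hw le_rfl
  set z : ℝ → ℝ := fun s => iteratedDerivWithin m w (Ici 0) (max s 0) with hz
  have hzc : Continuous z := continuous_iteratedDerivWithin_max hw le_rfl
  set P₁ : ℝ → ℝ := fun t => ∑ j ∈ Finset.range m, e₁ j * ((γ₁ - 1 - j) * t ^ (γ₁ - 1 - j - 1))
    with hP₁
  set P₂ : ℝ → ℝ := fun t => ∑ j ∈ Finset.range m, e₂ j * ((γ₂ - 1 - j) * t ^ (γ₂ - 1 - j - 1))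
    with hP₂
  have hderA : ∀ t > 0, DifferentiableAt ℝ (iteratedDeriv m (fracInt γ₁ w)) t →
      HasDerivAt (fracInt γ₁ z) (A t - P₁ t) t := by
    intro t ht hd
    have h1 := hd.hasDerivAt
    rw [← iteratedDeriv_succ] at h1
    refine (h1.sub (hasDerivAt_sum_rpow (γ := γ₁) ht m e₁)).congr_of_eventuallyEq ?_
    filter_upwards [Ioi_mem_nhds ht] with r hr
    rw [Pi.sub_apply, he₁ r hr]
    ring
  have hderB : ∀ t > 0, DifferentiableAt ℝ (iteratedDeriv m (fracInt γ₂ w)) t →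
      HasDerivAt (fracInt γ₂ z) (Bd t - P₂ t) t := by
    intro t ht hd
    have h1 := hd.hasDerivAt
    rw [← iteratedDeriv_succ] at h1
    refine (h1.sub (hasDerivAt_sum_rpow (γ := γ₂) ht m e₂)).congr_of_eventuallyEq ?_
    filter_upwards [Ioi_mem_nhds ht] with r hr
    rw [Pi.sub_apply, he₂ r hr]
    ring
  have hdA : ∀ t > T, A t ≠ 0 → ∀ᶠ s in nhds t, HasDerivAt (fracInt γ₁ z) (A s - P₁ s) s := by
    intro t ht hAt
    have h1 := (hA.continuousAt (Ioi_mem_nhds ht)).eventually_ne hAt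
    filter_upwards [h1, Ioi_mem_nhds ht] with s hs hsT
    refine hderA s (hT.trans_lt hsT) (differentiableAt_of_deriv_ne_zero ?_)
    rwa [← iteratedDeriv_succ]
  have hdB : ∀ t > T, HasDerivAt (fracInt γ₂ z) (Bd t - P₂ t) t := by
    intro t ht
    have ht0 : 0 < t := hT.trans_lt ht
    refine hderB t ht0 ?_
    by_cases hAt : A t = 0
    · refine differentiableAt_of_deriv_ne_zero ?_
      rw [← iteratedDeriv_succ]
      have h1 := hle t ht
      rw [← heq t ht, hAt, zero_add] at h1
      have h2 : 0 < c * t ^ (-ρ) := mul_pos hc (Real.rpow_pos_of_pos ht0 _)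
      intro h3
      rw [← hBdef] at h3
      rw [h3] at h1
      linarith
    · have h1 : DifferentiableAt ℝ (fracInt (γ₂ - γ₁) (fracInt γ₁ z)) t := by
        refine differentiableAt_fracInt (by linarith) ht0 (continuousOn_fracInt hγ₁ hzc)
          (hdA t ht hAt) ?_
        filter_upwards [Ioi_mem_nhds ht] with s hs
        exact (hA.continuousAt (Ioi_mem_nhds hs)).sub
          ((continuousOn_sum_deriv_rpow m e₁).continuousAt (Ioi_mem_nhds (hT.trans_lt hs)))
      refine (h1.add (hasDerivAt_sum_rpow (γ := γ₂) ht0 m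
        e₂).differentiableAt).congr_of_eventuallyEq ?_
      filter_upwards [Ioi_mem_nhds ht0] with r hr
      rw [Pi.add_apply, he₂ r hr, fracInt_fracInt (by linarith) hγ₁ (le_of_lt hr) hzc,
        sub_add_cancel]
  obtain ⟨T', hT'⟩ := eventually_atTop.mp (((eventually_abs_sum_deriv_rpow_le (by linarith : γ₁ < 1)
    hρ1 (by positivity : 0 < c / 4) m e₁).and (eventually_abs_sum_deriv_rpow_le hγ₂ hρ1
    (by positivity : 0 < c / (4 * a)) m e₂)).and (eventually_gt_atTop T))
  have hsub : Ioi T' ⊆ Ioi T := fun t ht => (hT' t (le_of_lt ht)).2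
  have hsub0 : Ioi T ⊆ Ioi 0 := fun t ht => hT.trans_lt ht
  have hmain := eventually_le_neg_rpow_of_zones (T := T') (c := c / 2) (ρ := ρ)
    (b := fun t => Bd t - P₂ t) (A := fun t => A t - P₁ t) hγ₁ (by linarith : 0 < γ₂ - γ₁)
    (by linarith) ha (by positivity) hρ hρ1 hzc
    ((hBc.sub ((continuousOn_sum_deriv_rpow m e₂).mono hsub0)).mono hsub)
    ((hA.sub ((continuousOn_sum_deriv_rpow m e₁).mono hsub0)).mono hsub)
    (fun t ht => by
      rw [add_sub_cancel]
      exact hdB t (hsub ht))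
    (fun t ht => by
      obtain ⟨⟨h1, h2⟩, h3⟩ := hT' t (le_of_lt ht)
      have ht0 : 0 < t := hT.trans_lt h3
      have h4 := hle t h3
      rw [← heq t h3] at h4
      have h5 := (abs_le.mp h1).1
      have h6 : a * -(P₂ t) ≤ c / 4 * t ^ (-ρ) := by
        have := mul_le_mul_of_nonneg_left ((neg_le_abs _).trans h2) ha.le
        refine this.trans (le_of_eq ?_)
        field_simp
      have h7 : -(c / 4 * t ^ (-ρ)) ≤ P₁ t := h5
      have h8 : 0 < c * t ^ (-ρ) := mul_pos hc (Real.rpow_pos_of_pos ht0 _)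
      rcases le_or_gt 0 (A t) with h | h
      · left
        linarith
      · right
        exact ⟨by linarith, hdA t h3 h.ne⟩)
  refine ⟨c / (16 * a), by positivity, ?_⟩
  filter_upwards [hmain, eventually_abs_sum_deriv_rpow_le hγ₂ hρ1
    (by positivity : 0 < c / (16 * a)) m e₂] with t h1 h2
  have h3 : P₂ t ≤ c / (16 * a) * t ^ (-ρ) := (le_abs_self _).trans h2
  have h4 : c / 2 / (4 * a) = 2 * (c / (16 * a)) := by field_simp; norm_num
  rw [h4] at h1
  linarith

theorem exists_abs_taylorPolyAt0_le (n : ℕ) (x : ℝ → ℝ) :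
    ∃ C, 0 ≤ C ∧ ∀ t ≥ 1, ∀ s ∈ Icc 0 t, |taylorPolyAt0 n x s| ≤ C * t ^ (n - 1) := by
  refine ⟨∑ k ∈ Finset.range n, |iteratedDeriv k x 0 / (Nat.factorial k : ℝ)|,
    Finset.sum_nonneg fun k _ => abs_nonneg _, fun t ht s hs => ?_⟩
  rw [taylorPolyAt0, Finset.sum_mul]
  refine (Finset.abs_sum_le_sum_abs _ _).trans (Finset.sum_le_sum fun k hk => ?_)
  rw [abs_mul, abs_of_nonneg (pow_nonneg hs.1 k)]
  refine mul_le_mul_of_nonneg_left ?_ (abs_nonneg _)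
  exact (pow_le_pow_left₀ hs.1 hs.2 k).trans
    (pow_le_pow_right₀ ht (by have := Finset.mem_range.mp hk; omega))

theorem contDiff_taylorPolyAt0 (n : ℕ) (x : ℝ → ℝ) {m : WithTop ℕ∞} :
    ContDiff ℝ m (taylorPolyAt0 n x) := by
  unfold taylorPolyAt0
  fun_prop

theorem exists_eventually_le_neg_rpow_of_iteratedDeriv {F : ℝ → ℝ} {ρ : ℝ} (hρ1 : ρ < 1) {m : ℕ}
    (hd : ∀ k < m, ∀ᶠ t in atTop, DifferentiableAt ℝ (iteratedDeriv k F) t)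
    (h : ∃ c > 0, ∀ᶠ t in atTop, iteratedDeriv m F t ≤ -c * t ^ (-ρ)) :
    ∃ c > 0, ∀ᶠ t in atTop, F t ≤ -c * t ^ (m - ρ) := by
  have key : ∀ j ≤ m, ∃ c > 0, ∀ᶠ t in atTop,
      iteratedDeriv (m - j) F t ≤ -c * t ^ ((j : ℝ) - ρ) := by
    intro j
    induction j with
    | zero => exact fun _ => by simpa using h
    | succ j ih =>
      intro hj
      obtain ⟨c, hc, hcj⟩ := ih (by omega)
      have h1 := eventually_le_neg_rpow_of_deriv (e := j - ρ) hc
        (by linarith [(Nat.cast_nonneg j : (0:ℝ) ≤ j)]) (hd (m - (j + 1)) (by omega)) (by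
          rw [← iteratedDeriv_succ, show m - (j + 1) + 1 = m - j by omega]
          exact hcj)
      rwa [show (j : ℝ) - ρ + 1 = ((j + 1 : ℕ) : ℝ) - ρ by push_cast; ring] at h1
  simpa using key m le_rfl

/-- An eventually positive function cannot have a Caputo-type integral of its Taylor remainder that
decays to `-∞` faster than the Taylor polynomial allows. -/
theorem not_eventually_fracInt_sub_taylor_le {γ ρ : ℝ} (hγ : 0 < γ) {n : ℕ} (hn : 1 ≤ n)
    (hργ : ρ + γ < 1) {x : ℝ → ℝ} (hx : ContinuousOn x (Ici 0))
    (hpos : ∃ T > (0:ℝ), ∀ t ≥ T, 0 < x t) :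
    ¬ ∃ c > 0, ∀ᶠ t in atTop,
      fracInt γ (fun s => x s - taylorPolyAt0 n x s) t ≤ -c * t ^ (n - ρ) := by
  rintro ⟨c, hc, hle⟩
  obtain ⟨T, hT0, hT⟩ := hpos
  obtain ⟨C, hC, hCb⟩ := exists_abs_taylorPolyAt0_le n x
  obtain ⟨M, hM⟩ := isCompact_Icc.exists_bound_of_continuousOn
    (hx.mono fun s (hs : s ∈ Icc 0 T) => hs.1)
  have hM0 : 0 ≤ M := (norm_nonneg _).trans (hM 0 ⟨le_rfl, hT0.le⟩)
  have hxM : ∀ s ≥ 0, -M ≤ x s := by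
    intro s hs
    rcases le_or_gt s T with h | h
    · exact (abs_le.mp (hM s ⟨hs, h⟩)).1
    · linarith [hT s h.le]
  have hΓ := Real.Gamma_pos_of_pos (by linarith : 0 < γ + 1)
  obtain ⟨t, ⟨h1, h2⟩, h3⟩ := ((hle.and (eventually_ge_atTop 1)).and
    (eventually_const_mul_rpow_neg_le (by linarith : 0 < 1 - (ρ + γ)) (half_pos hc)
      ((M + C) / Real.Gamma (γ + 1)))).exists
  have ht0 : 0 < t := by linarith
  have hp1 : 1 ≤ t ^ (n - 1) := one_le_pow₀ h2
  have h4 := neg_mul_rpow_le_fracInt (D := (M + C) * t ^ (n - 1)) hγ ht0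
    (w := fun s => x s - taylorPolyAt0 n x s)
    ((hx.sub (contDiff_taylorPolyAt0 n x (m := 0)).continuous.continuousOn).mono
      fun s hs => hs.1) fun s hs => by
        have h5 := (abs_le.mp (hCb t h2 s hs)).2
        have h6 := hxM s hs.1
        have h7 := mul_le_mul_of_nonneg_left hp1 hM0
        linarith
  have h5 : t ^ (n - ρ) = t ^ (n - 1) * (t ^ γ * t ^ (1 - (ρ + γ))) := by
    rw [← Real.rpow_natCast, ← Real.rpow_add ht0, ← Real.rpow_add ht0, Nat.cast_sub hn]
    congr 1
    push_cast
    ring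
  have h6 : t ^ (-(1 - (ρ + γ))) * t ^ (1 - (ρ + γ)) = 1 := by
    rw [← Real.rpow_add ht0, neg_add_cancel, Real.rpow_zero]
  have hX : 0 < t ^ (n - 1) * (t ^ γ * t ^ (1 - (ρ + γ))) := by positivity
  have h7 := mul_le_mul_of_nonneg_right h3 hX.le
  have h8 : (M + C) / Real.Gamma (γ + 1) * t ^ (-(1 - (ρ + γ))) *
      (t ^ (n - 1) * (t ^ γ * t ^ (1 - (ρ + γ)))) =
      (M + C) / Real.Gamma (γ + 1) * (t ^ (n - 1) * t ^ γ) := by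
    linear_combination (M + C) / Real.Gamma (γ + 1) * (t ^ (n - 1) * t ^ γ) * h6
  rw [h8] at h7
  rw [h5] at h1
  have h9 : -((M + C) * t ^ (n - 1)) / Real.Gamma (γ + 1) * t ^ γ =
      -((M + C) / Real.Gamma (γ + 1) * (t ^ (n - 1) * t ^ γ)) := by ring
  rw [h9] at h4
  have h10 := mul_pos hc hX
  linarith

/-- if `x` is eventually positive and `y_1` eventually negative,
then `y_1 → 0` and `y_2` is eventually positive. -/
theorem stmt14
    (n : ℕ) (hn3 : 3 ≤ n)
    (α β a : ℝ)
    (hβ : (n : ℝ) - 1 < β) (hβα : β < α) (hceil : ⌈α⌉₊ = n)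
    (ha : 0 < a)
    (f : ℝ → ℝ) (q g : ℝ → ℝ)
    (hfc : Continuous f) (hqc : ContinuousOn q (Set.Ici 0))
    (hgc : ContinuousOn g (Set.Ici 0))
    (hG1 : ∀ u : ℝ, u ≠ 0 → 0 < u * f u)
    (hH : ∃ T₁ > (0:ℝ), ∃ c₃ > (0:ℝ), ∀ t ≥ T₁, c₃ ≤ q t)
    (hK : ∃ σ : ℝ, (n : ℝ) - β < σ ∧ σ < 1 ∧
      ∃ c₄ > (0:ℝ), ∃ T₂ > (0:ℝ), ∀ t ≥ T₂, c₄ * t ^ ((n : ℝ) - β - σ) ≤ g t)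
    (ξ : ℕ → ℝ) (x : ℝ → ℝ)
    (hx : ContCaputoDiffOnIci α x)
    (heq : ∀ t > (0:ℝ),
      caputoD α x t + a * caputoD β x t + q t * f (x t) + Real.sign (x t) * g t = 0)
    (hinit : ∀ i < n, iteratedDeriv i x 0 = ξ i)
    (hxpos : ∃ T > (0:ℝ), ∀ t ≥ T, 0 < x t)
    (hy1neg : ∃ T > (0:ℝ), ∀ t ≥ T, assocY n α β a ξ x 1 t < 0) :
    Filter.Tendsto (assocY n α β a ξ x 1) Filter.atTop (nhds 0) ∧
      ∃ T > (0:ℝ), ∀ t ≥ T, 0 < assocY n α β a ξ x 2 t := by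
  exfalso
  obtain ⟨T₁, hT₁, c₃, hc₃, hq⟩ := hH
  obtain ⟨σ, hσ, hσ1, c₄, hc₄, T₂, hT₂, hg⟩ := hK
  obtain ⟨T₃, hT₃, hxT⟩ := hxpos
  have hαn : α ≤ n := hceil ▸ Nat.le_ceil α
  have hβceil : ⌈β⌉₊ = n := by
    rw [Nat.ceil_eq_iff (by omega), Nat.cast_sub (by omega), Nat.cast_one]
    exact ⟨hβ, hβα.le.trans hαn⟩
  obtain ⟨hx1, hx2⟩ := hx
  rw [hceil] at hx1
  obtain ⟨m, rfl⟩ : ∃ m, n = m + 1 := ⟨n - 1, by omega⟩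
  rw [Nat.add_sub_cancel] at hx1
  have hxc : ContinuousOn x (Ici 0) := hx1.continuousOn
  have hw := hx1.sub (contDiff_taylorPolyAt0 (m + 1) x (m := m)).contDiffOn (s := Ici 0)
  simp only [caputoD, hceil, hβceil] at heq hx2
  have hT0 : 0 ≤ max T₁ (max T₂ T₃) := hT₁.le.trans (le_max_left _ _)
  have hsub : Ioi (max T₁ (max T₂ T₃)) ⊆ Ici 0 := fun t ht => hT0.trans (le_of_lt ht)
  have hmain := eventually_iteratedDeriv_fracInt_le (γ₁ := ((m + 1 : ℕ) : ℝ) - α)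
    (γ₂ := ((m + 1 : ℕ) : ℝ) - β) (ρ := σ - (((m + 1 : ℕ) : ℝ) - β)) (a := a) (c := c₄)
    (T := max T₁ (max T₂ T₃)) (m := m) (w := fun s => x s - taylorPolyAt0 (m + 1) x s)
    (h := fun t => -(q t * f (x t) + g t))
    (by linarith) (by linarith) (by linarith) (by linarith) (by linarith) ha hc₄
    hT0 hw ?_ (hx2.mono ?_) (fun t ht => ?_) (fun t ht => ?_)
  · refine not_eventually_fracInt_sub_taylor_le (n := m + 1) (γ := ((m + 1 : ℕ) : ℝ) - β)
      (ρ := σ - (((m + 1 : ℕ) : ℝ) - β)) (by linarith) (by omega) (by linarith) hxc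
      ⟨T₃, hT₃, hxT⟩ (exists_eventually_le_neg_rpow_of_iteratedDeriv (by linarith) ?_ hmain)
    intro k hk
    rcases Nat.lt_succ_iff_lt_or_eq.mp hk with hk | rfl
    · filter_upwards [eventually_gt_atTop 0] with t ht
      exact differentiableAt_iteratedDeriv_fracInt (by linarith) ht hw hk
    · obtain ⟨c, hc, hle⟩ := hmain
      filter_upwards [hle, eventually_gt_atTop 0] with t ht ht0
      refine differentiableAt_of_deriv_ne_zero ?_
      rw [← iteratedDeriv_succ]
      refine ne_of_lt (ht.trans_lt ?_)
      have := mul_pos hc (Real.rpow_pos_of_pos ht0 (-(σ - (((k + 1 : ℕ) : ℝ) - β))))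
      linarith
  · exact (((hqc.mul (hfc.comp_continuousOn hxc)).add hgc).neg).mono hsub
  · exact hsub
  · have h1 := heq t (hT0.trans_lt ht)
    rw [Real.sign_of_pos (hxT t ((le_max_right _ _).trans ((le_max_right _ _).trans
      (le_of_lt ht))))] at h1
    linarith
  · have hx0 := hxT t ((le_max_right _ _).trans ((le_max_right _ _).trans (le_of_lt ht)))
    have h1 := hq t ((le_max_left _ _).trans (le_of_lt ht))
    have h2 := hg t ((le_max_left _ _).trans ((le_max_right _ _).trans (le_of_lt ht)))
    have h3 : 0 < f (x t) := (pos_iff_pos_of_mul_pos (hG1 (x t) hx0.ne')).mp hx0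
    have h4 := mul_pos (hc₃.trans_le h1) h3
    rw [neg_sub]
    linarith
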